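/- arXiv:2512.10800 — 9 statements merged into one kernel-verified Lean document; each statement's English description precedes it below -/
import Mathlib

section
/- Theorem IV (Higman–Neumann–Neumann, 1949). Every countable group G can be embedded in a group generated by two elements: there exists a group H, an injective group homomorphism i : G →* H, and elements a, b ∈ H such that the subgroup generated by {a, b} is all of H (Subgroup.closure {a, b} = ⊤). -/
namespace HNNAux

/-- conjugates of one generator by powers of the other -/
def conjHom (a b : Bool) : FreeGroup ℤ →* FreeGroup Bool :=
  FreeGroup.lift fun n : ℤ => FreeGroup.of a ^ n * FreeGroup.of b * (FreeGroup.of a ^ n)⁻¹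

lemma conjHom_injective (a b : Bool) (hab : b ≠ a) : Function.Injective (conjHom a b) := by
  let σ : MulAut (FreeGroup ℤ) := FreeGroup.freeGroupCongr (Equiv.addRight (1 : ℤ))
  let φ : Multiplicative ℤ →* MulAut (FreeGroup ℤ) := zpowersHom _ σ
  let X : FreeGroup ℤ ⋊[φ] Multiplicative ℤ := SemidirectProduct.inr (Multiplicative.ofAdd 1)
  let e : ℤ → FreeGroup ℤ ⋊[φ] Multiplicative ℤ := fun n => SemidirectProduct.inl (FreeGroup.of n)
  have h1 : ∀ n : ℤ, X * e n * X⁻¹ = e (n + 1) := by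
    intro n
    have := SemidirectProduct.inl_aut (φ := φ) (Multiplicative.ofAdd 1) (FreeGroup.of n)
    simp only [X, e]
    rw [← map_inv, ← this]
    simp [φ, σ]
  have h2 : ∀ n : ℤ, X ^ n * e 0 * (X ^ n)⁻¹ = e n := by
    intro n
    induction n using Int.induction_on with
    | zero => simp
    | succ k ih => rw [← h1, ← ih, add_comm, zpow_one_add]; group
    | pred k ih =>
      have h3 := h1 (-(k:ℤ) - 1)
      rw [sub_add_cancel, ← ih] at h3
      have h4 : e (-(k:ℤ) - 1) = X⁻¹ * (X * e (-(k:ℤ) - 1) * X⁻¹) * X := by group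
      rw [h4, h3]; group
  let ψ : FreeGroup Bool →* FreeGroup ℤ ⋊[φ] Multiplicative ℤ :=
    FreeGroup.lift fun c => if c = a then X else e 0
  have h5 : ψ.comp (conjHom a b) = SemidirectProduct.inl := by
    ext1 n
    simp only [MonoidHom.comp_apply, conjHom, FreeGroup.lift_apply_of, map_mul, map_inv, map_zpow, ψ,
      if_true, if_neg hab]
    exact h2 n
  have h6 : Function.Injective (ψ.comp (conjHom a b)) := by
    rw [h5]; exact SemidirectProduct.inl_injective
  exact Function.Injective.of_comp (f := ψ) (by simpa using h6)

lemma main (G : Type) [Group G] [Countable G] :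
    ∃ (H : Type) (_ : Group H) (i : G →* H) (a b : H),
      Function.Injective i ∧ Subgroup.closure {a, b} = (⊤ : Subgroup H) := by
  obtain ⟨g', hg'⟩ := exists_surjective_nat G
  let g : ℤ → G := fun n => if n ≤ 0 then 1 else g' (n - 1).toNat
  have hg0 : g 0 = 1 := by simp [g]
  have hg : Function.Surjective g := by
    intro z
    obtain ⟨n, rfl⟩ := hg' z
    refine ⟨n + 1, ?_⟩
    have : ¬ ((n : ℤ) + 1 ≤ 0) := by omega
    simp [g, this]
  let K := Monoid.Coprod G (FreeGroup Bool)
  let f1 : FreeGroup ℤ →* K := (Monoid.Coprod.inr).comp (conjHom true false)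
  let f2 : FreeGroup ℤ →* K := FreeGroup.lift fun n =>
    Monoid.Coprod.inl (g n) * Monoid.Coprod.inr (conjHom false true (FreeGroup.of n))
  have hf1 : Function.Injective f1 :=
    Monoid.Coprod.inr_injective.comp (conjHom_injective _ _ (by decide))
  have hf2 : Function.Injective f2 := by
    have : (Monoid.Coprod.snd : K →* FreeGroup Bool).comp f2 = conjHom false true := by
      ext1 n
      simp [f2, K]
    have h := conjHom_injective false true (by decide)
    rw [← this] at h
    exact Function.Injective.of_comp (f := (Monoid.Coprod.snd : K →* FreeGroup Bool)) (by simpa using h)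
  let φ : f1.range ≃* f2.range := (MonoidHom.ofInjective hf1).symm.trans (MonoidHom.ofInjective hf2)
  let H := HNNExtension K f1.range f2.range φ
  let o : K →* H := HNNExtension.of
  let t : H := HNNExtension.t
  have key : ∀ w, t * o (f1 w) = o (f2 w) * t := by
    intro w
    have h := HNNExtension.t_mul_of (φ := φ) (MonoidHom.ofInjective hf1 w)
    have e1 : φ (MonoidHom.ofInjective hf1 w) = MonoidHom.ofInjective hf2 w := by simp [φ]
    rw [e1] at h
    exact h
  let x : H := o (Monoid.Coprod.inr (FreeGroup.of true))
  let y : H := o (Monoid.Coprod.inr (FreeGroup.of false))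
  have key' : ∀ n : ℤ, t * (x ^ n * y * (x ^ n)⁻¹) = o (Monoid.Coprod.inl (g n)) * (y ^ n * x * (y ^ n)⁻¹) * t := by
    intro n
    have := key (FreeGroup.of n)
    simpa [f1, f2, conjHom, x, y] using this
  refine ⟨H, inferInstance, o.comp Monoid.Coprod.inl, t, x, ?_, ?_⟩
  · exact (HNNExtension.of_injective (φ := φ)).comp Monoid.Coprod.inl_injective
  · set S := Subgroup.closure {t, x} with hS
    have ht : t ∈ S := Subgroup.subset_closure (by simp)
    have hx : x ∈ S := Subgroup.subset_closure (by simp)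
    have hy : y ∈ S := by
      have h := key' 0
      simp only [hg0, map_one, zpow_zero, one_mul, inv_one, mul_one] at h
      have : y = t⁻¹ * (x * t) := by rw [← h]; group
      rw [this]
      exact S.mul_mem (S.inv_mem ht) (S.mul_mem hx ht)
    have hG : ∀ z, o (Monoid.Coprod.inl z) ∈ S := by
      intro z
      obtain ⟨n, rfl⟩ := hg z
      have h : o (Monoid.Coprod.inl (g n)) =
          (t * (x ^ n * y * (x ^ n)⁻¹)) * ((y ^ n * x * (y ^ n)⁻¹) * t)⁻¹ := by
        rw [key' n]; group
      rw [h]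
      have hxn := S.zpow_mem hx n
      have hyn := S.zpow_mem hy n
      exact S.mul_mem (S.mul_mem ht (S.mul_mem (S.mul_mem hxn hy) (S.inv_mem hxn)))
        (S.inv_mem (S.mul_mem (S.mul_mem (S.mul_mem hyn hx) (S.inv_mem hyn)) ht))
    have hF : ∀ w : FreeGroup Bool, o (Monoid.Coprod.inr w) ∈ S := by
      intro w
      induction w using FreeGroup.induction_on with
      | C1 => simp
      | of c => cases c <;> assumption
      | inv_of c h => rw [map_inv, map_inv]; exact S.inv_mem h
      | mul u v hu hv => rw [map_mul, map_mul]; exact S.mul_mem hu hv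
    have hK : ∀ k : K, o k ∈ S := by
      intro k
      induction k using Monoid.Coprod.induction_on with
      | inl z => exact hG z
      | inr w => exact hF w
      | mul u v hu hv => rw [map_mul]; exact S.mul_mem hu hv
    rw [eq_top_iff]
    intro h _
    induction h using HNNExtension.induction_on with
    | of k => exact hK k
    | t => exact ht
    | mul u v hu hv => exact S.mul_mem (hu trivial) (hv trivial)
    | inv u hu => exact S.inv_mem (hu trivial)

end HNNAux

/-- Theorem IV (Higman–Neumann–Neumann, 1949): every countable group embeds in a
two-generator group. -/
theorem hnn_theorem_IV (G : Type*) [Group G] [Countable G] :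
    ∃ (H : Type*) (_ : Group H) (i : G →* H) (a b : H),
      Function.Injective i ∧ Subgroup.closure {a, b} = (⊤ : Subgroup H) := by
  have : Countable (Shrink.{0} G) := (equivShrink.{0} G).symm.injective.countable
  obtain ⟨H, _, i, a, b, hi, hab⟩ := HNNAux.main (Shrink.{0} G)
  let e : H ≃* ULift H := MulEquiv.ulift.symm
  refine ⟨ULift H, inferInstance, (e.toMonoidHom.comp i).comp (Shrink.mulEquiv.{0} (α := G)).symm.toMonoidHom,
    e a, e b, ?_, ?_⟩
  · exact (e.injective.comp hi).comp (Shrink.mulEquiv.{0} (α := G)).symm.injective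
  · have h := congrArg (Subgroup.map e.toMonoidHom) hab
    rw [MonoidHom.map_closure, Subgroup.map_top_of_surjective _ e.surjective,
      Set.image_pair] at h
    exact h
end

section
/- Every finite subgroup of an HNN extension is conjugate into the base group: if G is a group, A, B are subgroups of G, φ : A ≃* B is an isomorphism, and K is a finite subgroup of HNNExtension G A B φ, then there exists x ∈ HNNExtension G A B φ such that x⁻¹ * k * x lies in the range of the canonical map of : G →* HNNExtension G A B φ for every k ∈ K. -/
open HNNExtension HNNExtension.NormalWord in
theorem hnn_len_not_cancels {G : Type*} [Group G] {A B : Subgroup G} (φ : A ≃* B)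
    {d : TransversalPair G A B} (u : ℤˣ) (w : NormalWord d) (h : ¬ Cancels u w) :
    (unitsSMul φ u w).toList.length = w.toList.length + 1 := by
  simp [unitsSMul, dif_neg h]

open HNNExtension HNNExtension.NormalWord in
theorem hnn_len_cancels {G : Type*} [Group G] {A B : Subgroup G} (φ : A ≃* B)
    {d : TransversalPair G A B} (u : ℤˣ) (w : NormalWord d) (h : Cancels u w) :
    (unitsSMul φ u w).toList.length < w.toList.length := by
  have h2 : ¬ Cancels (-u) (unitsSMul φ u w) := by
    rw [unitsSMul_cancels_iff]; exact not_not.2 h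
  have := hnn_len_not_cancels φ (-u) _ h2
  rw [unitsSMul_neg] at this
  omega

open HNNExtension HNNExtension.NormalWord in
theorem hnn_step {G : Type*} [Group G] {A B : Subgroup G} (φ : A ≃* B)
    {d : TransversalPair G A B} (a : ℤˣ × G) (W : NormalWord d) :
    (t ^ (a.1 : ℤ) * of a.2 : HNNExtension G A B φ)⁻¹ • W
      = a.2⁻¹ • unitsSMul φ (-a.1) W := by
  rw [mul_inv_rev, mul_smul, ← t_pow_smul_eq_unitsSMul, ← of_smul_eq_smul (φ := φ)]
  simp

open HNNExtension HNNExtension.NormalWord in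
theorem hnn_len_list {G : Type*} [Group G] {A B : Subgroup G} (φ : A ≃* B)
    {d : TransversalPair G A B} (l : List (ℤˣ × G)) :
    ∀ (W : NormalWord d),
    l.IsChain (fun a b => a.2 ∈ toSubgroup A B a.1 → a.1 = b.1) →
    (∀ a ∈ l.head?, ¬ Cancels (-a.1) W) →
    (((l.map (fun x => (t ^ (x.1 : ℤ) * of x.2 : HNNExtension G A B φ))).prod)⁻¹ • W).toList.length
      = W.toList.length + l.length := by
  induction l with
  | nil => intro W _ _; simp
  | cons a l ih =>
    intro W hc hW
    have hW' := hW a (by simp)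
    rw [List.map_cons, List.prod_cons, mul_inv_rev, mul_smul, hnn_step,
      ih _ (List.isChain_cons.1 hc).2]
    · rw [group_smul_toList, hnn_len_not_cancels φ _ _ hW', List.length_cons]; omega
    · intro b hb hcan
      have h1 := (List.isChain_cons.1 hc).1 b hb
      have h2 := (unitsSMul_cancels_iff φ (-a.1) W).2 hW'
      rw [neg_neg] at h2
      obtain ⟨h3, h4⟩ := h2
      obtain ⟨h5, h6⟩ := hcan
      rw [group_smul_toList, h4] at h6
      rw [group_smul_head] at h5
      have hab : a.1 = -b.1 := by
        have h7 : -a.1 = b.1 := by simpa using h6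
        rw [← h7, neg_neg]
      rw [← hab, Subgroup.mul_mem_cancel_right _ h3, inv_mem_iff] at h5
      have := h1 h5
      rw [this] at hab
      rcases Int.units_eq_one_or b.1 with h | h <;> rw [h] at hab <;> revert hab <;> decide

open HNNExtension HNNExtension.NormalWord in
/-- Every finite subgroup of an HNN extension is conjugate into the base group. -/
theorem finite_subgroup_hnn_conjugate_into_base (G : Type*) [Group G]
    (A B : Subgroup G) (φ : A ≃* B) (K : Subgroup (HNNExtension G A B φ))
    (hK : Finite K) :
    ∃ x : HNNExtension G A B φ, ∀ k ∈ K,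
      x⁻¹ * k * x ∈ (HNNExtension.of : G →* HNNExtension G A B φ).range := by
  classical
  obtain ⟨d⟩ := TransversalPair.nonempty G A B
  have := Fintype.ofFinite K
  let e : NormalWord d := NormalWord.empty
  let f : HNNExtension G A B φ → ℕ := fun x =>
    Finset.univ.sup (fun k : K => (x⁻¹ • ((k : HNNExtension G A B φ) • e)).toList.length)
  have hf : ∀ x (k : K), (x⁻¹ • ((k : HNNExtension G A B φ) • e)).toList.length ≤ f x :=
    fun x k => Finset.le_sup
      (f := fun k : K => (x⁻¹ • ((k : HNNExtension G A B φ) • e)).toList.length)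
      (Finset.mem_univ k)
  have hinv : ∀ x (k : K), f ((k : HNNExtension G A B φ) * x) ≤ f x := by
    intro x k
    refine Finset.sup_le fun k' _ => ?_
    have := hf x (k⁻¹ * k')
    simpa [mul_smul] using this
  obtain ⟨x, hx⟩ : ∃ x, ∀ y, f x ≤ f y :=
    ⟨Function.argmin f, fun y => Function.argmin_le f y⟩
  refine ⟨x, fun k hk => ?_⟩
  generalize hy : x⁻¹ * k * x = y
  have hprod : (y • e).prod φ = y := by simp [e]
  have hch := (y • e).chain
  rw [ReducedWord.prod] at hprod
  generalize (y • e).head = h at hprod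
  generalize (y • e).toList = l at hprod hch
  match l, hprod, hch with
  | [], hprod, _ => exact ⟨h, by simpa using hprod⟩
  | [a], hprod, _ =>
    exfalso
    let σ : HNNExtension G A B φ →* Multiplicative ℤ :=
      HNNExtension.lift 1 (Multiplicative.ofAdd 1) (by simp)
    have hσk : σ k = 1 := by
      have h1 : (⟨k, hk⟩ : K) ^ Nat.card K = 1 := pow_card_eq_one'
      have h2 : k ^ Nat.card K = 1 := congrArg Subtype.val h1
      have h3 : (σ k) ^ Nat.card K = 1 := by rw [← map_pow, h2, map_one]
      have h4 : Nat.card K ≠ 0 := Nat.card_pos.ne'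
      exact (pow_eq_one_iff_left h4).1 h3
    have h1 : σ y = 1 := by rw [← hy]; simp [hσk]
    rw [← hprod] at h1
    rcases Int.units_eq_one_or a.1 with hu | hu <;> simp [σ, hu] at h1
  | a :: b :: l, hprod, hch =>
    exfalso
    let w : HNNExtension G A B φ := of h * (t ^ (a.1 : ℤ) * of a.2)
    have key : ∀ k' : K, ((x * w)⁻¹ • ((k' : HNNExtension G A B φ) • e)).toList.length < f x := by
      intro k'
      have e1 := hf x k'
      have e2 := (hf (k * x) k').trans (hinv x ⟨k, hk⟩)
      have hkx : k * x = x * y := by rw [← hy]; group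
      rw [hkx, mul_inv_rev, mul_smul] at e2
      rw [mul_inv_rev, mul_smul]
      generalize x⁻¹ • ((k' : HNNExtension G A B φ) • e) = W at e1 e2 ⊢
      have hW : (h⁻¹ • W).toList = W.toList := group_smul_toList ..
      have hw : w⁻¹ • W = a.2⁻¹ • unitsSMul φ (-a.1) (h⁻¹ • W) := by
        rw [← hnn_step, mul_inv_rev, mul_smul, ← of_smul_eq_smul (φ := φ) h⁻¹, map_inv]
      rw [hw, group_smul_toList]
      by_cases hc : Cancels (-a.1) (h⁻¹ • W)
      · have := hnn_len_cancels φ _ _ hc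
        rw [hW] at this
        omega
      · rw [hnn_len_not_cancels φ _ _ hc, hW]
        have := hnn_len_list φ (a :: b :: l) (h⁻¹ • W) hch (by simpa using hc)
        rw [← of_smul_eq_smul (φ := φ) h⁻¹, map_inv, ← mul_smul, ← mul_inv_rev, hprod,
          ← map_inv, of_smul_eq_smul, hW] at this
        simp only [List.length_cons] at this
        omega
    have hpos : 0 < f x := lt_of_le_of_lt (Nat.zero_le _) (key 1)
    have : f (x * w) < f x := (Finset.sup_lt_iff hpos).2 fun k' _ => key k'
    exact absurd (hx (x * w)) (not_le.2 this)
end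

section
/- Every finite subgroup of an amalgamated free product is conjugate into one of the factors: let A, B, C be groups and let ι_A : C →* A and ι_B : C →* B be injective homomorphisms, and let P = A *_C B be the amalgamated free product (the pushout of A ← C → B in the category of groups, e.g. Mathlib's Monoid.PushoutI over a two-element index type), with canonical homomorphisms j_A : A →* P and j_B : B →* P. If K is a finite subgroup of P, then there exists x ∈ P such that either x⁻¹ * k * x ∈ j_A.range for all k ∈ K, or x⁻¹ * k * x ∈ j_B.range for all k ∈ K. -/
namespace AmalgamProof

open Monoid Monoid.PushoutI

variable {ι : Type*} {G : ι → Type*} {H : Type*} [∀ i, Group (G i)] [Group H]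

/-- Elements of the pushout having a reduced expression of a given type. -/
def R (φ : ∀ i, H →* G i) : List ι → Set (PushoutI φ)
  | [] => {x | ∃ h, x = base φ h}
  | i :: l => {x | ∃ g : G i, g ∉ (φ i).range ∧ ∃ y ∈ R φ l, x = of i g * y}

variable {φ : ∀ i, H →* G i}

theorem base_mul (c : H) {l : List ι} {x : PushoutI φ} (hx : x ∈ R φ l) :
    base φ c * x ∈ R φ l := by
  cases l with
  | nil => obtain ⟨h, rfl⟩ := hx; exact ⟨c * h, by simp⟩
  | cons i l =>
    obtain ⟨g, hg, y, hy, rfl⟩ := hx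
    refine ⟨φ i c * g, ?_, y, hy, ?_⟩
    · rwa [Subgroup.mul_mem_cancel_left _ (show φ i c ∈ (φ i).range from ⟨c, rfl⟩)]
    · rw [map_mul, of_apply_eq_base, mul_assoc]

theorem mul_mem {l l' : List ι} {x y : PushoutI φ} (hx : x ∈ R φ l) (hy : y ∈ R φ l') :
    x * y ∈ R φ (l ++ l') := by
  induction l generalizing x with
  | nil => obtain ⟨h, rfl⟩ := hx; exact base_mul h hy
  | cons i l ih =>
    obtain ⟨g, hg, z, hz, rfl⟩ := hx
    exact ⟨g, hg, z * y, ih hz, mul_assoc _ _ _⟩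

theorem mul_base {l : List ι} {x : PushoutI φ} (hx : x ∈ R φ l) (c : H) :
    x * base φ c ∈ R φ l := by
  have := mul_mem hx (show base φ c ∈ R φ [] from ⟨c, rfl⟩)
  rwa [List.append_nil] at this

theorem single {i : ι} {g : G i} (hg : g ∉ (φ i).range) : of i g ∈ R φ [i] :=
  ⟨g, hg, 1, ⟨1, by simp⟩, by simp⟩

theorem inv_mem {l : List ι} {x : PushoutI φ} (hx : x ∈ R φ l) : x⁻¹ ∈ R φ l.reverse := by
  induction l generalizing x with
  | nil => obtain ⟨h, rfl⟩ := hx; exact ⟨h⁻¹, by simp⟩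
  | cons i l ih =>
    obtain ⟨g, hg, z, hz, rfl⟩ := hx
    rw [mul_inv_rev, List.reverse_cons, ← map_inv]
    exact mul_mem (ih hz) (single (by rwa [Subgroup.inv_mem_iff]))

theorem split_last {l : List ι} {i : ι} {x : PushoutI φ} (hx : x ∈ R φ (l ++ [i])) :
    ∃ y ∈ R φ l, ∃ g : G i, g ∉ (φ i).range ∧ x = y * of i g := by
  induction l generalizing x with
  | nil =>
    obtain ⟨g, hg, z, ⟨c, rfl⟩, rfl⟩ := hx
    refine ⟨1, ⟨1, by simp⟩, g * φ i c, ?_, ?_⟩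
    · rwa [Subgroup.mul_mem_cancel_right _ (show φ i c ∈ (φ i).range from ⟨c, rfl⟩)]
    · rw [map_mul, of_apply_eq_base, one_mul]
  | cons j l ih =>
    obtain ⟨g, hg, z, hz, rfl⟩ := hx
    obtain ⟨y, hy, g', hg', rfl⟩ := ih hz
    exact ⟨of j g * y, ⟨g, hg, y, hy, rfl⟩, g', hg', (mul_assoc _ _ _).symm⟩

/-- alternating -/
abbrev Alt (l : List ι) : Prop := l.IsChain (· ≠ ·)

theorem exists_normal (d : NormalWord.Transversal φ) {l : List ι} (hl : Alt l)
    {x : PushoutI φ} (hx : x ∈ R φ l) :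
    ∃ w : NormalWord d, w.prod = x ∧ w.toList.map Sigma.fst = l := by
  induction l generalizing x with
  | nil =>
    obtain ⟨h, rfl⟩ := hx
    exact ⟨⟨.empty, h, by simp⟩, by simp [NormalWord.prod], rfl⟩
  | cons i l ih =>
    obtain ⟨g, hg, z, hz, rfl⟩ := hx
    obtain ⟨w, hw, hwl⟩ := ih hl.tail hz
    refine ⟨NormalWord.cons g w ?_ hg, ?_, ?_⟩
    · rw [CoprodI.Word.fstIdx, ← List.head?_map, hwl]
      cases l with
      | nil => simp
      | cons j l =>
        simp only [Alt, List.isChain_cons_cons] at hl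
        simpa using hl.1.symm
    · rw [NormalWord.prod_cons, hw]
    · simp [NormalWord.cons, hwl]

theorem uniq (hφ : ∀ i, Function.Injective (φ i)) {l l' : List ι} (hl : Alt l) (hl' : Alt l')
    {x : PushoutI φ} (hx : x ∈ R φ l) (hx' : x ∈ R φ l') : l = l' := by
  obtain ⟨d⟩ := NormalWord.transversal_nonempty φ hφ
  obtain ⟨w, hw, rfl⟩ := exists_normal d hl hx
  obtain ⟨w', hw', rfl⟩ := exists_normal d hl' hx'
  rw [NormalWord.prod_injective (hw.trans hw'.symm)]

theorem exists_R (hφ : ∀ i, Function.Injective (φ i)) (x : PushoutI φ) :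
    ∃ l, Alt l ∧ x ∈ R φ l := by
  classical
  obtain ⟨d⟩ := NormalWord.transversal_nonempty φ hφ
  have key : ∀ w : NormalWord d, w.prod ∈ R φ (w.toList.map Sigma.fst) := by
    intro w
    induction w using NormalWord.consRecOn with
    | empty => exact ⟨1, by simp⟩
    | cons i g w h1 h2 h3 h4 ih =>
      rw [NormalWord.prod_cons]
      exact ⟨g, h3, _, ih, rfl⟩
    | base h w h1 ih =>
      rw [NormalWord.prod_smul]
      exact base_mul h ih
  have := key (x • NormalWord.empty)
  rw [NormalWord.prod_smul, NormalWord.prod_empty, mul_one] at this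
  refine ⟨_, ?_, this⟩
  rw [Alt, List.isChain_map]
  exact (x • (NormalWord.empty : NormalWord d)).chain_ne

theorem claim (hφ : ∀ i, Function.Injective (φ i)) {n : ℕ} {K : Set (PushoutI φ)}
    (hmul : ∀ x ∈ K, ∀ y ∈ K, x⁻¹ * y ∈ K)
    (hn : ∀ x ∈ K, ∀ l, Alt l → x ∈ R φ l → l.length ≤ n)
    {i : ι} {l : List ι} (hl : Alt (i :: l)) (hln : l.length + 1 = n)
    {g : G i} (hg : g ∉ (φ i).range) {y : PushoutI φ} (hy : y ∈ R φ l) (hk : of i g * y ∈ K)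
    {j : ι} {l' : List ι} (hl' : Alt (j :: l'))
    {g' : G j} (hg' : g' ∉ (φ j).range) {y' : PushoutI φ} (hy' : y' ∈ R φ l')
    (hk' : of j g' * y' ∈ K) :
    i = j ∧ (l' ≠ [] → ∃ c, of j g' = of i g * base φ c) := by
  have h1 : Alt (l.reverse ++ [i]) := by
    rw [← List.reverse_cons, Alt, List.isChain_reverse]
    exact hl.imp fun _ _ h => h.symm
  have hK := hmul _ hk _ hk'
  have hij : i = j := by
    by_contra hij
    have hm := mul_mem (inv_mem (show of i g * y ∈ R φ (i :: l) from ⟨g, hg, y, hy, rfl⟩))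
      (show of j g' * y' ∈ R φ (j :: l') from ⟨g', hg', y', hy', rfl⟩)
    have := hn _ hK _ ?_ hm
    · simp at this; omega
    · rw [List.reverse_cons, Alt, List.isChain_append]
      refine ⟨h1, hl', ?_⟩
      simpa using hij
  subst hij
  refine ⟨rfl, fun hne => ?_⟩
  by_cases hr : g⁻¹ * g' ∈ (φ i).range
  · obtain ⟨c, hc⟩ := hr
    refine ⟨c, ?_⟩
    rw [← of_apply_eq_base φ i, hc, ← map_mul, mul_inv_cancel_left]
  · exfalso
    have hm := mul_mem (inv_mem hy) (show of i (g⁻¹ * g') * y' ∈ R φ (i :: l') from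
      ⟨_, hr, y', hy', rfl⟩)
    have e : y⁻¹ * (of i (g⁻¹ * g') * y') = (of i g * y)⁻¹ * (of i g' * y') := by
      simp [mul_assoc]
    rw [e] at hm
    have := hn _ hK _ ?_ hm
    · have := List.length_pos_iff.2 hne
      simp at *; omega
    · rw [Alt, List.isChain_append] at h1 ⊢
      refine ⟨h1.1, hl', ?_⟩
      simpa using h1.2.2

theorem main [Nonempty ι] (hφ : ∀ i, Function.Injective (φ i)) (K : Subgroup (PushoutI φ))
    (hK : Finite K) :
    ∃ (x : PushoutI φ) (i : ι), ∀ k ∈ K, x⁻¹ * k * x ∈ (of (φ := φ) i).range := by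
  classical
  let P : ℕ → Prop := fun n => ∃ x : PushoutI φ, ∀ k ∈ K, ∀ l, Alt l →
    x⁻¹ * k * x ∈ R φ l → l.length ≤ n
  have hP : ∃ n, P n := by
    choose L hL hLR using exists_R hφ
    obtain ⟨n, hn⟩ := (Set.finite_range (fun k : K => (L k).length)).bddAbove
    refine ⟨n, 1, fun k hk l hl hkl => ?_⟩
    rw [inv_one, one_mul, mul_one] at hkl
    rw [uniq hφ hl (hL k) hkl (hLR k)]
    exact hn ⟨⟨k, hk⟩, rfl⟩
  obtain ⟨x, hx⟩ := Nat.find_spec hP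
  have hmin := fun m => Nat.find_min hP (m := m)
  generalize Nat.find hP = n at hx hmin
  let K' : Set (PushoutI φ) := {z | x * z * x⁻¹ ∈ K}
  have hmul : ∀ a ∈ K', ∀ b ∈ K', a⁻¹ * b ∈ K' := by
    intro a ha b hb
    have := K.mul_mem (K.inv_mem ha) hb
    simpa [K', mul_assoc] using this
  have hone : (1 : PushoutI φ) ∈ K' := by simp [K', K.one_mem]
  have hinv : ∀ a ∈ K', a⁻¹ ∈ K' := fun a ha => by simpa using hmul a ha 1 hone
  have hn : ∀ a ∈ K', ∀ l, Alt l → a ∈ R φ l → l.length ≤ n := by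
    intro a ha l hl hal
    refine hx _ ha l hl ?_
    simpa [mul_assoc] using hal
  have hto : ∀ k ∈ K, x⁻¹ * k * x ∈ K' := by
    intro k hk
    simpa [K', mul_assoc] using hk
  by_cases h2 : ∃ a ∈ K', ∃ l, Alt l ∧ a ∈ R φ l ∧ l ≠ [] ∧ l.length = n
  · obtain ⟨a, ha, l, hl, hal, hne, hln⟩ := h2
    cases l with
    | nil => exact absurd rfl hne
    | cons i l =>
    obtain ⟨g, hg, y, hy, rfl⟩ := hal
    have hln' : l.length + 1 = n := by simpa using hln
    -- every other element
    have hone' : ∀ b ∈ K', ∀ j, b ∈ R φ [j] → b ∈ (of (φ := φ) i).range := by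
      intro b hb j hbj
      obtain ⟨g', hg', y', hy', rfl⟩ := hbj
      obtain ⟨rfl, -⟩ := claim hφ hmul hn hl hln' hg hy ha (List.isChain_singleton _) hg' hy' hb
      obtain ⟨c, rfl⟩ := hy'
      exact ⟨g' * φ i c, by rw [map_mul, of_apply_eq_base]⟩
    have hzero : ∀ b, b ∈ R φ [] → b ∈ (of (φ := φ) i).range := by
      rintro b ⟨c, rfl⟩
      exact ⟨φ i c, of_apply_eq_base φ i c⟩
    by_cases hl0 : l = []
    · refine ⟨x, i, fun k hk => ?_⟩
      obtain ⟨l', hl', hkl⟩ := exists_R hφ (x⁻¹ * k * x)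
      have := hn _ (hto k hk) l' hl' hkl
      subst hl0
      match l', this with
      | [], _ => exact hzero _ hkl
      | [j], _ => exact hone' _ (hto k hk) j hkl
      | _ :: _ :: _, h => simp at h hln'; omega
    · exfalso
      have hlp := List.length_pos_iff.2 hl0
      refine hmin (n - 1) (by omega) ⟨x * of i g, fun k hk l₁ hl₁ hkl₁ => ?_⟩
      have hb := hto k hk
      have e : (x * of i g)⁻¹ * k * (x * of i g) = (of i g)⁻¹ * (x⁻¹ * k * x) * of i g := by
        simp [mul_assoc]
      rw [e] at hkl₁
      generalize x⁻¹ * k * x = b at hb hkl₁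
      have hrange : b ∈ (of (φ := φ) i).range → l₁.length ≤ n - 1 := by
        rintro ⟨g', rfl⟩
        rw [← map_inv, ← map_mul, ← map_mul] at hkl₁
        by_cases hr : g⁻¹ * g' * g ∈ (φ i).range
        · obtain ⟨c, hc⟩ := hr
          rw [← hc, of_apply_eq_base] at hkl₁
          rw [uniq hφ hl₁ List.isChain_nil hkl₁ ⟨c, rfl⟩]
          simp
        · rw [uniq hφ hl₁ (List.isChain_singleton _) hkl₁ (single hr)]
          simp; omega
      obtain ⟨l', hl', hbl⟩ := exists_R hφ b
      have hlen := hn _ hb l' hl' hbl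
      match l', hl', hbl, hlen with
      | [], _, hbl, _ => exact hrange (hzero _ hbl)
      | [j], _, hbl, _ => exact hrange (hone' _ hb j hbl)
      | j :: j₁ :: l₂, hl', hbl, hlen =>
        obtain ⟨m, j', hm⟩ : ∃ m j', j₁ :: l₂ = m ++ [j'] :=
          ⟨_, _, (List.dropLast_append_getLast (List.cons_ne_nil _ _)).symm⟩
        rw [hm] at hl' hbl hlen
        obtain ⟨h1, hh1, w, hw, rfl⟩ := hbl
        obtain ⟨z, hz, h3, hh3, rfl⟩ := split_last hw
        obtain ⟨rfl, hc0⟩ := claim hφ hmul hn hl hln' hg hy ha hl' hh1 hw hb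
        obtain ⟨c, hc⟩ := hc0 (by simp)
        have hbi := hinv _ hb
        have e2 : (of i h1 * (z * of j' h3))⁻¹ = of j' h3⁻¹ * (z⁻¹ * of i h1⁻¹) := by
          simp [mul_assoc]
        rw [e2] at hbi
        have hl3 : Alt (j' :: (m.reverse ++ [i])) := by
          have : Alt (i :: (m ++ [j'])).reverse := by
            rw [Alt, List.isChain_reverse]
            exact hl'.imp fun _ _ h => h.symm
          simpa using this
        obtain ⟨rfl, hc1⟩ := claim hφ hmul hn hl hln' hg hy ha hl3
          (g' := h3⁻¹) (by rwa [Subgroup.inv_mem_iff])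
          (mul_mem (inv_mem hz) (single (g := h1⁻¹) (by rwa [Subgroup.inv_mem_iff]))) hbi
        obtain ⟨c', hc'⟩ := hc1 (by simp)
        have hc2 : of i h3 = (base φ c')⁻¹ * (of (φ := φ) i g)⁻¹ := by
          rw [← mul_inv_rev, ← hc', map_inv, inv_inv]
        have e3 : (of i g)⁻¹ * (of i h1 * (z * of i h3)) * of i g
            = base φ c * (z * base φ c'⁻¹) := by
          rw [hc, hc2]; simp [mul_assoc]
        rw [e3] at hkl₁
        have hma : Alt m := (List.isChain_append.1 hl'.tail).1
        rw [uniq hφ hl₁ hma hkl₁ (base_mul c (mul_base hz _))]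
        simp at hlen; omega
  · -- then everything is in the base
    obtain ⟨i⟩ := ‹Nonempty ι›
    refine ⟨x, i, fun k hk => ?_⟩
    rcases Nat.eq_zero_or_pos n with h0 | h0
    · obtain ⟨l', hl', hkl⟩ := exists_R hφ (x⁻¹ * k * x)
      have := hn _ (hto k hk) l' hl' hkl
      have : l' = [] := List.length_eq_zero_iff.1 (by omega)
      subst this
      obtain ⟨c, hc⟩ := hkl
      exact ⟨φ i c, by rw [hc, of_apply_eq_base]⟩
    · exfalso
      refine hmin (n - 1) (by omega) ⟨x, fun k hk l hl hkl => ?_⟩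
      have h3 := hx k hk l hl hkl
      by_contra h4
      refine h2 ⟨_, hto k hk, l, hl, hkl, ?_, by omega⟩
      rintro rfl
      simp at h4

end AmalgamProof


/-- The two-element family of groups `A` (at `false`) and `B` (at `true`) used to form the
amalgamated free product `A *_C B` as Mathlib's `Monoid.PushoutI`. -/
def AmalgamFam (A B : Type u) : Bool → Type u := fun b => Bool.rec A B b

instance AmalgamFam.group (A B : Type u) [Group A] [Group B] :
    ∀ b, Group (AmalgamFam A B b) := fun b => by cases b <;> dsimp [AmalgamFam] <;> infer_instance

/-- The family of maps `C →* A` (at `false`) and `C →* B` (at `true`) along which the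
amalgamated free product is formed. -/
def AmalgamMaps {A B : Type u} {C : Type v} [Group A] [Group B] [Group C]
    (ιA : C →* A) (ιB : C →* B) : ∀ b, C →* AmalgamFam A B b :=
  fun b => Bool.rec ιA ιB b

/-- Every finite subgroup of an amalgamated free product `A *_C B` (over injective maps
`ι_A : C →* A`, `ι_B : C →* B`) is conjugate into one of the two factors, whose canonical
maps into the pushout are `j_A = Monoid.PushoutI.of _ false` and
`j_B = Monoid.PushoutI.of _ true`. -/
theorem finite_subgroup_amalgam_conjugate_into_factor
    (A B : Type u) (C : Type v) [Group A] [Group B] [Group C]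
    (ιA : C →* A) (ιB : C →* B)
    (hA : Function.Injective ιA) (hB : Function.Injective ιB)
    (K : Subgroup (Monoid.PushoutI (AmalgamMaps ιA ιB))) (hK : Finite K) :
    ∃ x : Monoid.PushoutI (AmalgamMaps ιA ιB),
      (∀ k ∈ K, x⁻¹ * k * x ∈
        (Monoid.PushoutI.of (φ := AmalgamMaps ιA ιB) false : A →* _).range) ∨
      (∀ k ∈ K, x⁻¹ * k * x ∈
        (Monoid.PushoutI.of (φ := AmalgamMaps ιA ιB) true : B →* _).range) := by


  have hφ : ∀ b, Function.Injective (AmalgamMaps ιA ιB b) := by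
    intro b
    cases b
    · exact hA
    · exact hB
  obtain ⟨x, i, h⟩ := AmalgamProof.main hφ K hK
  refine ⟨x, ?_⟩
  cases i
  · exact Or.inl h
  · exact Or.inr h
end

section
/- (Baumslag, 1962.) HNN extensions of finite groups are residually finite: if G is a finite group, A and B are subgroups of G, and φ : A ≃* B is an isomorphism, then for every element h ≠ 1 of HNNExtension G A B φ there exists a finite group F and a group homomorphism ψ : HNNExtension G A B φ →* F with ψ h ≠ 1. -/
theorem aux_free.{u, v} {A : Type u} {H : Type v} [Group A] [Group H] (i : A →* H) (hi : Function.Injective i)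
    (S : Set H) (hS : ∀ a, ∀ x ∈ S, i a * x ∈ S) :
    ∃ (Q : Type v) (e : A × Q ≃ S), ∀ a b q, (e (a * b, q) : H) = i a * e (b, q) := by
  let r : Setoid S :=
    { r := fun x y => ∃ a, i a * (x : H) = y
      iseqv := ⟨fun x => ⟨1, by simp⟩, fun {x y} ⟨a, h⟩ => ⟨a⁻¹, by simp [← h]⟩,
        fun {x y z} ⟨a, h⟩ ⟨b, h'⟩ => ⟨b * a, by simp [← h, ← h', mul_assoc]⟩⟩ }
  let f : A × Quotient r → S := fun p => ⟨i p.1 * (p.2.out : S), hS _ _ (p.2.out).2⟩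
  have hf : Function.Bijective f := by
    constructor
    · rintro ⟨a, q⟩ ⟨b, q'⟩ h
      have h1 : i a * (q.out : H) = i b * (q'.out : H) := congrArg Subtype.val h
      have h2 : q = q' := by
        rw [← q.out_eq, ← q'.out_eq]
        apply Quotient.sound
        exact ⟨b⁻¹ * a, by simp [mul_assoc, h1]⟩
      subst h2
      have := hi (mul_right_cancel h1)
      rw [this]
    · intro y
      obtain ⟨a, ha⟩ : r.r (Quotient.out (Quotient.mk r y)) y := Quotient.mk_out y
      exact ⟨(a, Quotient.mk r y), Subtype.ext ha⟩
  exact ⟨Quotient r, Equiv.ofBijective f hf, fun a b q => by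
    change i (a * b) * (q.out : H) = i a * (i b * q.out)
    rw [map_mul, mul_assoc]⟩

theorem aux_equiv {A H : Type*} [Group A] [Finite A] [Group H] (i j : A →* H)
    (hi : Function.Injective i) (hj : Function.Injective j)
    (S T : Set H) (hS : ∀ a, ∀ x ∈ S, i a * x ∈ S) (hT : ∀ a, ∀ x ∈ T, j a * x ∈ T)
    (fS : S.Finite) (fT : T.Finite) (hc : S.ncard = T.ncard) :
    ∃ e : S ≃ T, ∀ a (x y : S), (y : H) = i a * x → (e y : H) = j a * e x := by
  obtain ⟨Q, e, he⟩ := aux_free i hi S hS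
  obtain ⟨Q', e', he'⟩ := aux_free j hj T hT
  have := fS.to_subtype
  have := fT.to_subtype
  have hQ : Finite Q := Finite.of_injective (fun q => e (1, q)) fun a b h => by simpa using h
  have hQ' : Finite Q' := Finite.of_injective (fun q => e' (1, q)) fun a b h => by simpa using h
  have hcard : Nat.card Q = Nat.card Q' := by
    have h1 := Nat.card_congr e
    have h2 := Nat.card_congr e'
    rw [Nat.card_prod] at h1 h2
    have h3 : Nat.card S = Nat.card T := hc
    rw [← h1, ← h2] at h3
    exact Nat.eq_of_mul_eq_mul_left Nat.card_pos h3
  obtain ⟨k⟩ := Finite.card_eq.1 hcard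
  refine ⟨(e.symm.trans (Equiv.prodCongr (Equiv.refl A) k)).trans e', ?_⟩
  intro a x y h
  obtain ⟨⟨b, q⟩, rfl⟩ := e.surjective x
  have : y = e (a * b, q) := Subtype.ext (by rw [h, he])
  subst this
  simp [he']

open HNNExtension in
theorem aux_hom {G : Type*} [Group G] [Finite G]
    {A B : Subgroup G} {φ : A ≃* B} (X : Set (HNNExtension G A B φ)) (fX : X.Finite)
    (hX : ∀ g, ∀ x ∈ X, of g * x ∈ X) :
    ∃ ψ : HNNExtension G A B φ →* Equiv.Perm X,
      (∀ g (x : X), (ψ (of g) x : HNNExtension G A B φ) = of g * (x : HNNExtension G A B φ)) ∧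
      (∀ x : X, t * (x : HNNExtension G A B φ) ∈ X →
        (ψ t x : HNNExtension G A B φ) = t * (x : HNNExtension G A B φ)) := by
  classical
  have := fX.to_subtype
  let i : A →* HNNExtension G A B φ := of.comp A.subtype
  let j : A →* HNNExtension G A B φ := (of.comp B.subtype).comp φ.toMonoidHom
  have hi : Function.Injective i := fun a b h => Subtype.ext (of_injective φ h)
  have hj : Function.Injective j := fun a b h =>
    φ.injective (Subtype.ext (of_injective φ h))
  have hij : ∀ a x, t * (i a * x) = j a * (t * x) := by
    intro a x
    rw [← mul_assoc, ← mul_assoc]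
    congr 1
    exact t_mul_of a
  have hiX : ∀ a x, x ∈ X → i a * x ∈ X := fun a x h => hX _ _ h
  have hjX : ∀ a x, x ∈ X → j a * x ∈ X := fun a x h => hX _ _ h
  have hiX' : ∀ a x, i a * x ∈ X → x ∈ X := fun a x h => by
    simpa [← mul_assoc, ← map_mul] using hiX a⁻¹ _ h
  have hjX' : ∀ a x, j a * x ∈ X → x ∈ X := fun a x h => by
    have := hjX a⁻¹ _ h
    rwa [← mul_assoc, ← map_mul, inv_mul_cancel, map_one, one_mul] at this
  have hij' : ∀ a x, t⁻¹ * (j a * x) = i a * (t⁻¹ * x) := by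
    intro a x
    rw [inv_mul_eq_iff_eq_mul, hij, mul_inv_cancel_left]
  let D : Set (HNNExtension G A B φ) := {x | x ∈ X ∧ t * x ∈ X}
  let R : Set (HNNExtension G A B φ) := {x | x ∈ X ∧ t⁻¹ * x ∈ X}
  have hDR : D.ncard = R.ncard := by
    have : R = (fun x => t * x) '' D := by
      ext x
      constructor
      · rintro ⟨h1, h2⟩
        exact ⟨t⁻¹ * x, ⟨h2, by simpa using h1⟩, by simp⟩
      · rintro ⟨y, ⟨h1, h2⟩, rfl⟩
        exact ⟨h2, by simpa using h1⟩
    rw [this, Set.ncard_image_of_injective _ (mul_right_injective t)]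
  have hDX : D ⊆ X := fun x h => h.1
  have hRX : R ⊆ X := fun x h => h.1
  have hc : (X \ D).ncard = (X \ R).ncard := by
    rw [Set.ncard_sdiff hDX (fX.subset hDX), Set.ncard_sdiff hRX (fX.subset hRX), hDR]
  obtain ⟨e, he⟩ := aux_equiv i j hi hj (X \ D) (X \ R)
    (fun a x h => ⟨hiX _ _ h.1, fun h' => h.2 ⟨h.1, hjX' a _ (by rw [← hij]; exact h'.2)⟩⟩)
    (fun a x h => ⟨hjX _ _ h.1, fun h' => h.2 ⟨h.1, hiX' a _ (by rw [← hij']; exact h'.2)⟩⟩)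
    fX.sdiff fX.sdiff hc
  let F : X → X := fun x => if h : t * (x : HNNExtension G A B φ) ∈ X then ⟨t * (x : HNNExtension G A B φ), h⟩ else
    ⟨e ⟨x, x.2, fun h' => h h'.2⟩, (e _).2.1⟩
  have F1 : ∀ x : X, t * (x : HNNExtension G A B φ) ∈ X →
      (F x : HNNExtension G A B φ) = t * (x : HNNExtension G A B φ) := fun x h => by simp [F, h]
  have F2 : ∀ (x : X) (h : t * (x : HNNExtension G A B φ) ∉ X),
      (F x : HNNExtension G A B φ) = e ⟨x, x.2, fun h' => h h'.2⟩ := fun x h => by simp [F, h]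
  have Finj : Function.Injective F := by
    intro x y hxy
    have hxy' : (F x : HNNExtension G A B φ) = F y := congrArg _ hxy
    by_cases h1 : t * (x : HNNExtension G A B φ) ∈ X <;>
      by_cases h2 : t * (y : HNNExtension G A B φ) ∈ X
    · rw [F1 x h1, F1 y h2] at hxy'
      exact Subtype.ext (mul_left_cancel hxy')
    · rw [F1 x h1, F2 y h2] at hxy'
      exfalso
      apply (e ⟨y, y.2, fun h' => h2 h'.2⟩).2.2
      rw [← hxy']
      exact ⟨h1, by simp⟩
    · rw [F1 y h2, F2 x h1] at hxy'
      exfalso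
      apply (e ⟨x, x.2, fun h' => h1 h'.2⟩).2.2
      rw [hxy']
      exact ⟨h2, by simp⟩
    · rw [F2 x h1, F2 y h2] at hxy'
      have := e.injective (Subtype.ext hxy')
      exact Subtype.ext (Subtype.mk.inj this)
  have Feq : ∀ a (x y : X), (y : HNNExtension G A B φ) = i a * x →
      (F y : HNNExtension G A B φ) = j a * F x := by
    intro a x y h
    by_cases h1 : t * (x : HNNExtension G A B φ) ∈ X
    · have h2 : t * (y : HNNExtension G A B φ) ∈ X := by rw [h, hij]; exact hjX _ _ h1
      rw [F1 x h1, F1 y h2, h, hij]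
    · have h2 : t * (y : HNNExtension G A B φ) ∉ X := by
        rw [h, hij]; exact fun h' => h1 (hjX' _ _ h')
      rw [F2 x h1, F2 y h2]
      exact he _ _ _ h
  let τ : Equiv.Perm X := Equiv.ofBijective F (Finite.injective_iff_bijective.1 Finj)
  let act : MulAction G X :=
    { smul := fun g x => ⟨of g * (x : HNNExtension G A B φ), hX _ _ x.2⟩
      one_smul := fun x => Subtype.ext (by 
        change of (1 : G) * (x : HNNExtension G A B φ) = (x : HNNExtension G A B φ); simp)
      mul_smul := fun g g' x => Subtype.ext (by
        change of (g * g') * (x : HNNExtension G A B φ) = of g * (of g' * (x : HNNExtension G A B φ))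
        simp [mul_assoc]) }
  refine ⟨lift (MulAction.toPermHom G X) τ ?_, ?_, ?_⟩
  · intro a
    ext x
    exact Feq a x _ rfl
  · intro g x
    rw [lift_of]
    rfl
  · intro x h
    rw [lift_t]
    exact F1 x h

open HNNExtension in
theorem aux_path {G : Type*} [Group G]
    {A B : Subgroup G} {φ : A ≃* B} (h : HNNExtension G A B φ) :
    ∀ x : HNNExtension G A B φ, ∃ S : Set (HNNExtension G A B φ), S.Finite ∧ x ∈ S ∧
      ∀ X : Set (HNNExtension G A B φ), S ⊆ X → ∀ ψ : HNNExtension G A B φ →* Equiv.Perm X,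
      (∀ g (x : X), (ψ (of g) x : HNNExtension G A B φ) = of g * (x : HNNExtension G A B φ)) →
      (∀ x : X, t * (x : HNNExtension G A B φ) ∈ X →
        (ψ t x : HNNExtension G A B φ) = t * (x : HNNExtension G A B φ)) →
      ∀ y : X, (y : HNNExtension G A B φ) = x → (ψ h y : HNNExtension G A B φ) = h * x := by
  induction h using induction_on with
  | of g =>
    intro x
    exact ⟨{x}, by simp, by simp, fun X hX ψ h1 h2 y hy => by rw [h1, hy]⟩
  | t =>
    intro x
    refine ⟨{x, t * x}, by simp, by simp, fun X hX ψ h1 h2 y hy => ?_⟩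
    rw [h2, hy]
    rw [hy]
    exact hX (by simp)
  | mul a b iha ihb =>
    intro x
    obtain ⟨S, fS, xS, hS⟩ := ihb x
    obtain ⟨T, fT, xT, hT⟩ := iha (b * x)
    refine ⟨S ∪ T, fS.union fT, Or.inl xS, fun X hX ψ h1 h2 y hy => ?_⟩
    rw [map_mul, Equiv.Perm.mul_apply, mul_assoc]
    apply hT X (fun z hz => hX (Or.inr hz)) ψ h1 h2
    exact hS X (fun z hz => hX (Or.inl hz)) ψ h1 h2 _ hy
  | inv a iha =>
    intro x
    obtain ⟨S, fS, xS, hS⟩ := iha (a⁻¹ * x)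
    refine ⟨insert x S, fS.insert x, by simp, fun X hX ψ h1 h2 y hy => ?_⟩
    have hz : a⁻¹ * x ∈ X := hX (Or.inr xS)
    have := hS X (fun z hz => hX (Or.inr hz)) ψ h1 h2 ⟨_, hz⟩ rfl
    have := Subtype.ext ((this.trans (mul_inv_cancel_left a x)).trans hy.symm)
    rw [map_inv, ← this]
    simp

/-- (Baumslag, 1962.) HNN extensions of finite groups are residually finite. -/
theorem hnnExtension_residuallyFinite (G : Type*) [Group G] [Finite G]
    (A B : Subgroup G) (φ : A ≃* B) (h : HNNExtension G A B φ) (hh : h ≠ 1) :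
    ∃ (F : Type) (_ : Group F) (_ : Finite F)
      (ψ : HNNExtension G A B φ →* F), ψ h ≠ 1 := by
  obtain ⟨S, fS, xS, hS⟩ := aux_path h 1
  let X : Set (HNNExtension G A B φ) :=
    Set.image2 (fun (g : G) x => HNNExtension.of g * x) Set.univ S
  have fX : X.Finite := Set.Finite.image2 _ Set.finite_univ fS
  have hSX : S ⊆ X := fun x hx => ⟨1, Set.mem_univ _, x, hx, by simp⟩
  obtain ⟨ψ, h1, h2⟩ := aux_hom X fX (by
    rintro g _ ⟨g', -, x, hx, rfl⟩
    exact ⟨g * g', Set.mem_univ _, x, hx, by simp [mul_assoc]⟩)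
  have key := hS X hSX ψ h1 h2 ⟨1, hSX xS⟩ rfl
  have := fX.to_subtype
  let k : X ≃ Fin (Nat.card X) := Finite.equivFin X
  refine ⟨Equiv.Perm (Fin (Nat.card X)), inferInstance, inferInstance,
    (k.permCongrHom.toMonoidHom).comp ψ, fun h0 => hh ?_⟩
  have h3 : ψ h = 1 := k.permCongrHom.injective (by rw [map_one]; exact h0)
  rw [h3] at key
  simpa using key.symm
end

section
/- If G is a finite group and a, b ∈ G are elements with orderOf a = orderOf b, then there exists a finite group H, an injective group homomorphism i : G →* H, and an element x ∈ H such that x⁻¹ * (i a) * x = i b. That is, any two elements of equal order in a finite group become conjugate in some finite overgroup. -/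
open Subgroup in
theorem exists_coset_param {G : Type*} [Group G] (a : G) :
    ∃ e : (G ⧸ zpowers a) × zpowers a ≃ G, ∀ q k, e (q, k) = k * (q.out)⁻¹ := by
  refine ⟨Equiv.ofBijective (fun p => (p.2 : G) * (p.1.out)⁻¹) ⟨?_, ?_⟩, fun q k => rfl⟩
  · rintro ⟨q, k⟩ ⟨q', k'⟩ hh
    simp only at hh
    have h1 : q = q' := by
      rw [← q.out_eq', ← q'.out_eq']
      refine Quotient.sound' ?_
      rw [QuotientGroup.leftRel_apply]
      have : (q.out)⁻¹ * q'.out = (k : G)⁻¹ * k' := by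
        rw [eq_inv_mul_iff_mul_eq, ← mul_assoc, hh]; group
      rw [this]
      exact mul_mem (inv_mem k.2) k'.2
    subst h1
    simpa using hh
  · intro g
    refine ⟨(QuotientGroup.mk g⁻¹, ⟨g * (QuotientGroup.mk g⁻¹ : G ⧸ zpowers a).out, ?_⟩), ?_⟩
    · have := QuotientGroup.eq (s := zpowers a) (a := g⁻¹)
        (b := (QuotientGroup.mk g⁻¹ : G ⧸ zpowers a).out)
      simpa using this
    · simp

open Subgroup in
theorem exists_conj_perm {G : Type*} [Group G] [Finite G] (a b : G)
    (h : orderOf a = orderOf b) : ∃ f : Equiv.Perm G, ∀ g, f (a * g) = b * f g := by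
  obtain ⟨e, he⟩ := exists_coset_param a
  obtain ⟨e', he'⟩ := exists_coset_param b
  have hc : Nat.card (G ⧸ zpowers a) = Nat.card (G ⧸ zpowers b) := by
    have h1 := card_eq_card_quotient_mul_card_subgroup (zpowers a)
    have h2 := card_eq_card_quotient_mul_card_subgroup (zpowers b)
    rw [Nat.card_zpowers] at h1 h2
    rw [h1, h] at h2
    exact Nat.eq_of_mul_eq_mul_right (orderOf_pos b) h2
  obtain ⟨t⟩ : Nonempty ((G ⧸ zpowers a) ≃ (G ⧸ zpowers b)) := ⟨(Finite.equivFinOfCardEq hc).trans (Finite.equivFin _).symm⟩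
  refine ⟨e.symm.trans ((t.prodCongr (zpowersEquivZPowers h)).trans e'), fun g => ?_⟩
  obtain ⟨⟨q, k, hk⟩, rfl⟩ := e.surjective g
  obtain ⟨n, rfl⟩ := (mem_powers_iff_mem_zpowers (x := a)).2 hk
  simp only at hk ⊢
  have h1 : a * e (q, ⟨a ^ n, hk⟩) = e (q, ⟨a ^ (n + 1), npow_mem_zpowers a (n + 1)⟩) := by
    simp [he, pow_succ', mul_assoc]
  rw [h1]
  have z : ∀ (n : ℕ) (hn : a ^ n ∈ zpowers a),
      ((zpowersEquivZPowers h ⟨a ^ n, hn⟩ : zpowers b) : G) = b ^ n := fun n hn => by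
    have := zpowersEquivZPowers_apply h n
    exact congrArg Subtype.val this
  simp [he', z]
  rw [pow_succ', mul_assoc]

/-- Any two elements of equal order in a finite group become conjugate in some finite
overgroup. -/
theorem finite_group_conjugating_overgroup (G : Type*) [Group G] [Finite G]
    (a b : G) (h : orderOf a = orderOf b) :
    ∃ (H : Type*) (_ : Group H) (_ : Finite H) (i : G →* H) (x : H),
      Function.Injective i ∧ x⁻¹ * i a * x = i b := by
  obtain ⟨f, hf⟩ := exists_conj_perm a b h
  let m : Equiv.Perm G ≃* ULift (Equiv.Perm (Fin (Nat.card G))) :=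
    (Finite.equivFin G).permCongrHom.trans MulEquiv.ulift.symm
  refine ⟨ULift (Equiv.Perm (Fin (Nat.card G))), inferInstance, inferInstance,
    m.toMonoidHom.comp (MulAction.toPermHom G G), m f⁻¹, ?_, ?_⟩
  · exact m.injective.comp MulAction.toPerm_injective
  · change (m f⁻¹)⁻¹ * m (MulAction.toPermHom G G a) * m f⁻¹ = m (MulAction.toPermHom G G b)
    rw [← map_inv, ← map_mul, ← map_mul]
    congr 1
    ext g
    simp [hf]
end

section
/- (Nagao, 1959.) For every field k, the general linear group GL₂(k[X]) of 2×2 invertible matrices over the polynomial ring k[X] is not finitely generated: ¬ Group.FG (GL (Fin 2) (Polynomial k)). -/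
open Polynomial in
def NS {k : Type*} [Field k] (n : ℕ) (a c : k[X]) : Prop :=
  ∀ p q : k[X], a * q - p * c ≠ 0 →
    max a.natDegree c.natDegree ≤ (a * q - p * c).natDegree + max p.natDegree q.natDegree + n

open Polynomial in
lemma NS_aux {k : Type*} [Field k] {a c p q d : k[X]} (hd : a * q - p * c = d)
    (hc : c ≠ 0) (hq : q ≠ 0) (h : d.natDegree + q.natDegree < c.natDegree) :
    max a.natDegree c.natDegree + q.natDegree = max p.natDegree q.natDegree + c.natDegree := by
  by_cases hp : p = 0
  · subst hp
    by_cases ha : a = 0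
    · subst ha; simp; omega
    · have : d.natDegree = a.natDegree + q.natDegree := by
        rw [← hd, ← natDegree_mul ha hq]; simp
      simp; omega
  · have h1 : (p * c).natDegree = p.natDegree + c.natDegree := natDegree_mul hp hc
    have h2 : (p * c + d).natDegree = (p * c).natDegree :=
      natDegree_add_eq_left_of_natDegree_lt (by omega)
    have h3 : p * c + d = a * q := by rw [← hd]; ring
    have ha : a ≠ 0 := by
      rintro rfl
      rw [h3] at h2
      simp at h2
      omega
    rw [h3, natDegree_mul ha hq] at h2
    omega

open Polynomial in
lemma NS_shift {k : Type*} [Field k] {n : ℕ} {a c f : k[X]} (hf : f.natDegree ≤ n)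
    (h : NS n a c) : NS n (a + f * c) c := by
  intro p' q hd
  obtain ⟨p, rfl⟩ : ∃ p, p' = p + f * q := ⟨p' - f * q, by ring⟩
  have e : (a + f * c) * q - (p + f * q) * c = a * q - p * c := by ring
  rw [e] at hd ⊢
  by_cases hc : c = 0
  · subst hc
    simp only [mul_zero, sub_zero, add_zero, natDegree_zero] at hd ⊢
    rw [natDegree_mul (left_ne_zero_of_mul hd) (right_ne_zero_of_mul hd)]
    omega
  have h1 := h 1 0 (by simpa using hc)
  simp at h1
  have h2 : (a + f * c).natDegree ≤ c.natDegree + n := by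
    refine (natDegree_add_le _ _).trans ?_
    have := natDegree_mul_le (p := f) (q := c)
    omega
  by_cases hq : q = 0
  · subst hq
    have hp : p ≠ 0 := by rintro rfl; simp at hd
    simp only [mul_zero, zero_sub, natDegree_neg, natDegree_mul hp hc, add_zero, natDegree_zero]
    omega
  by_cases hl : (a * q - p * c).natDegree + q.natDegree < c.natDegree
  · have l1 := NS_aux rfl hc hq hl
    have l2 := NS_aux e hc hq hl
    have := h p q hd
    omega
  · omega

open Polynomial in
lemma NS_swap {k : Type*} [Field k] {n : ℕ} {a c : k[X]}
    (h : NS n a c) : NS n c a := by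
  intro p q hd
  have e : a * p - q * c = -(c * q - p * a) := by ring
  have := h q p (by rw [e]; exact neg_ne_zero.mpr hd)
  rw [e, natDegree_neg] at this
  omega

open Polynomial in
lemma NS_diag {k : Type*} [Field k] {n : ℕ} {a c : k[X]} {u v : k} (hu : u ≠ 0) (hv : v ≠ 0)
    (h : NS n a c) : NS n (C u * a) (C v * c) := by
  intro p q hd
  have e : C u * a * q - p * (C v * c) = a * (C u * q) - (C v * p) * c := by ring
  rw [e] at hd ⊢
  have := h _ _ hd
  rw [natDegree_C_mul hu, natDegree_C_mul hv] at *
  exact this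

open Polynomial in
lemma NS_all {k : Type*} [Field k] (m : ℕ) : ∀ (a b c d : k[X]), IsUnit (a * d - b * c) →
    c.degree < m → ∃ N, ∀ n ≥ N, ∀ x y, NS n x y → NS n (a * x + b * y) (c * x + d * y) := by
  induction m with
  | zero =>
    intro a b c d hu hc
    have hc : c = 0 := by
      rw [← degree_eq_bot]
      exact Nat.WithBot.lt_zero_iff.mp (by simpa using hc)
    subst hc
    simp only [mul_zero, sub_zero] at hu
    obtain ⟨r, hr, rfl⟩ := Polynomial.isUnit_iff.mp (isUnit_of_mul_isUnit_left hu)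
    obtain ⟨s, hs, rfl⟩ := Polynomial.isUnit_iff.mp (isUnit_of_mul_isUnit_right hu)
    refine ⟨(C s⁻¹ * b).natDegree, fun n hn x y h => ?_⟩
    have h1 := NS_shift hn (NS_diag hr.ne_zero hs.ne_zero h)
    have e : C s⁻¹ * b * (C s * y) = b * y := by
      have : C s⁻¹ * C s = (1 : k[X]) := by rw [← C_mul, inv_mul_cancel₀ hs.ne_zero, C_1]
      linear_combination b * y * this
    rw [e] at h1
    simpa using h1
  | succ m ih =>
    intro a b c d hu hc
    by_cases h0 : c = 0
    · exact ih a b c d hu (by subst h0; simp [WithBot.bot_lt_coe])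
    have hr : a - c * (a / c) = a % c := by
      rw [EuclideanDomain.mod_eq_sub_mul_div]
    have hdeg : (a % c).degree < m := by
      have h1 := Polynomial.degree_mod_lt a h0
      rw [degree_eq_natDegree h0] at h1 hc
      have : c.natDegree < m + 1 := by exact_mod_cast hc
      refine h1.trans_le ?_
      exact_mod_cast (by omega : c.natDegree ≤ m)
    obtain ⟨N, hN⟩ := ih c d (a - c * (a / c)) (b - d * (a / c))
      (by
        have : c * (b - d * (a / c)) - d * (a - c * (a / c)) = -(a * d - b * c) := by ring
        rw [this]; exact hu.neg) (by rw [hr]; exact hdeg)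
    refine ⟨max N (a / c).natDegree, fun n hn x y h => ?_⟩
    have h1 := NS_shift (f := a / c) (by omega) (NS_swap (hN n (by omega) x y h))
    convert h1 using 1
    ring

/-- (Nagao, 1959.) For every field `k`, the group `GL₂(k[X])` is not finitely generated. -/
theorem nagao_GL2_polynomial_not_fg (k : Type*) [Field k] :
    ¬ Group.FG (GL (Fin 2) (Polynomial k)) := by
  intro hFG
  obtain ⟨S, hS⟩ := (Monoid.fg_def.mp (Group.fg_iff_monoid_fg.mp hFG))
  have key : ∀ g : GL (Fin 2) (Polynomial k), ∃ N, ∀ n ≥ N, ∀ x y, NS n x y →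
      NS n (g.1 0 0 * x + g.1 0 1 * y) (g.1 1 0 * x + g.1 1 1 * y) := by
    intro g
    refine NS_all ((g.1 1 0).natDegree + 1) _ _ _ _ ?_ ?_
    · rw [← Matrix.det_fin_two]
      exact (Matrix.isUnit_iff_isUnit_det _).mp g.isUnit
    · exact (Polynomial.degree_le_natDegree).trans_lt (by exact_mod_cast Nat.lt_succ_self _)
  choose N hN using key
  set n := S.sup N with hn
  have all : ∀ g : GL (Fin 2) (Polynomial k), ∀ x y, NS n x y →
      NS n (g.1 0 0 * x + g.1 0 1 * y) (g.1 1 0 * x + g.1 1 1 * y) := by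
    intro g
    have hg : g ∈ Submonoid.closure (S : Set (GL (Fin 2) (Polynomial k))) := by
      rw [hS]; trivial
    induction hg using Submonoid.closure_induction with
    | mem g hg => exact hN g n (Finset.le_sup (f := N) hg)
    | one => intro x y h; simpa using h
    | mul g g' _ _ h1 h2 =>
      intro x y h
      have := h1 _ _ (h2 x y h)
      simp only [Units.val_mul, Matrix.mul_apply, Fin.sum_univ_two]
      convert this using 1 <;> ring
  have h0 : NS n (0 : Polynomial k) 1 := by
    intro p q _
    simp
  have hdet : IsUnit (!![1, Polynomial.X ^ (n + 1); 0, 1] :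
      Matrix (Fin 2) (Fin 2) (Polynomial k)) := by
    rw [Matrix.isUnit_iff_isUnit_det, Matrix.det_fin_two]
    simp
  have h1 := all hdet.unit 0 1 h0
  simp only [IsUnit.unit_spec] at h1
  have h2 := h1 1 0 (by simp)
  simp at h2
end

section
/- SL₂(ℤ) is the amalgamated free product of cyclic groups of orders 4 and 6 over a cyclic group of order 2: letting f : ZMod 2 →* ZMod 4 be the injective homomorphism sending the generator to the unique element of order 2 (1 ↦ 2) and g : ZMod 2 →* ZMod 6 the injective homomorphism sending the generator to the unique element of order 2 (1 ↦ 3) (viewing these cyclic groups multiplicatively), the special linear group SL₂(ℤ) is isomorphic as a group to the amalgamated free product (ZMod 4) *_{ZMod 2} (ZMod 6), i.e., to the pushout of ZMod 4 ← ZMod 2 → ZMod 6 in the category of groups. -/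
/-- The injective homomorphism `ZMod 2 →* ZMod 4` (written multiplicatively) sending the
generator `1` to the unique element `2` of order 2. -/
def f24 : Multiplicative (ZMod 2) →* Multiplicative (ZMod 4) :=
  AddMonoidHom.toMultiplicative (ZMod.lift 2 ⟨zmultiplesHom (ZMod 4) 2, by decide⟩)

/-- The injective homomorphism `ZMod 2 →* ZMod 6` (written multiplicatively) sending the
generator `1` to the unique element `3` of order 2. -/
def f26 : Multiplicative (ZMod 2) →* Multiplicative (ZMod 6) :=
  AddMonoidHom.toMultiplicative (ZMod.lift 2 ⟨zmultiplesHom (ZMod 6) 3, by decide⟩)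

/-- The two-element family of groups `ZMod 4` (at `false`) and `ZMod 6` (at `true`),
written multiplicatively. -/
def SL2ZFam : Bool → Type := fun b => Bool.rec (Multiplicative (ZMod 4)) (Multiplicative (ZMod 6)) b

instance SL2ZFam.group : ∀ b, Group (SL2ZFam b) := fun b => by
  cases b <;> dsimp [SL2ZFam] <;> infer_instance

/-- The pair of maps `ZMod 2 →* ZMod 4` and `ZMod 2 →* ZMod 6` defining the amalgam
`(ZMod 4) *_{ZMod 2} (ZMod 6)`. -/
def SL2ZMaps : ∀ b, Multiplicative (ZMod 2) →* SL2ZFam b := fun b => Bool.rec f24 f26 b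

open Matrix in
/-- The order four matrix. -/
def slS : Matrix.SpecialLinearGroup (Fin 2) ℤ := ⟨!![0, -1; 1, 0], by decide⟩

open Matrix in
/-- The order six matrix. -/
def slU : Matrix.SpecialLinearGroup (Fin 2) ℤ := ⟨!![0, -1; 1, 1], by decide⟩

lemma slS_four : slS ^ 4 = 1 := by decide
lemma slU_six : slU ^ 6 = 1 := by decide

/-- Hom from a cyclic group. -/
def cycHom {G : Type*} [Group G] (n : ℕ) [NeZero n] (g : G) (h : g ^ n = 1) :
    Multiplicative (ZMod n) →* G where
  toFun x := g ^ (x.toAdd.val)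
  map_one' := by simp
  map_mul' x y := by
    rw [toAdd_mul, ZMod.val_add, ← pow_add, ← pow_mod_orderOf,
      Nat.mod_mod_of_dvd _ (orderOf_dvd_of_pow_eq_one h), pow_mod_orderOf]

/-- The two homs. -/
def slFam : ∀ b, SL2ZFam b →* Matrix.SpecialLinearGroup (Fin 2) ℤ
  | false => cycHom 4 slS slS_four
  | true => cycHom 6 slU slU_six

lemma slFam_comp : ∀ b, (slFam b).comp (SL2ZMaps b) = cycHom 2 (slS ^ 2) (by decide)
  | false => by
    apply MonoidHom.ext
    change ∀ x : ZMod 2, slS ^ ((f24 (Multiplicative.ofAdd x)).toAdd.val) = (slS ^ 2) ^ x.val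
    decide
  | true => by
    apply MonoidHom.ext
    change ∀ x : ZMod 2, slU ^ ((f26 (Multiplicative.ofAdd x)).toAdd.val) = (slS ^ 2) ^ x.val
    decide

/-- The comparison map. -/
def slPhi : Monoid.PushoutI SL2ZMaps →* Matrix.SpecialLinearGroup (Fin 2) ℤ :=
  Monoid.PushoutI.lift slFam (cycHom 2 (slS ^ 2) (by decide)) slFam_comp

/-- The first inclusion. -/
def ofF : Multiplicative (ZMod 4) →* Monoid.PushoutI SL2ZMaps :=
  Monoid.PushoutI.of (φ := SL2ZMaps) false

/-- The second inclusion. -/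
def ofT : Multiplicative (ZMod 6) →* Monoid.PushoutI SL2ZMaps :=
  Monoid.PushoutI.of (φ := SL2ZMaps) true

/-- Generator of order four. -/
def pS : Monoid.PushoutI SL2ZMaps := ofF (Multiplicative.ofAdd (1 : ZMod 4))

/-- Generator of order six. -/
def pU : Monoid.PushoutI SL2ZMaps := ofT (Multiplicative.ofAdd (1 : ZMod 6))

lemma slPhi_pS : slPhi pS = slS := by
  refine (Monoid.PushoutI.lift_of slFam _ slFam_comp (i := false) _).trans ?_
  change slS ^ (1 : ZMod 4).val = slS
  decide

lemma slPhi_pU : slPhi pU = slU := by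
  refine (Monoid.PushoutI.lift_of slFam _ slFam_comp (i := true) _).trans ?_
  change slU ^ (1 : ZMod 6).val = slU
  decide

lemma ofF_eq (x : Multiplicative (ZMod 4)) : ofF x = pS ^ x.toAdd.val := by
  unfold pS
  rw [← map_pow]
  congr 1
  revert x
  change ∀ x : ZMod 4, Multiplicative.ofAdd x = (Multiplicative.ofAdd (1 : ZMod 4)) ^ x.val
  decide

lemma ofT_eq (x : Multiplicative (ZMod 6)) : ofT x = pU ^ x.toAdd.val := by
  unfold pU
  rw [← map_pow]
  congr 1
  revert x
  change ∀ x : ZMod 6, Multiplicative.ofAdd x = (Multiplicative.ofAdd (1 : ZMod 6)) ^ x.val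
  decide

lemma base_eq (x : Multiplicative (ZMod 2)) :
    Monoid.PushoutI.base SL2ZMaps x = ofF (f24 x) :=
  (Monoid.PushoutI.of_apply_eq_base SL2ZMaps false x).symm

lemma base_eq' (x : Multiplicative (ZMod 2)) :
    Monoid.PushoutI.base SL2ZMaps x = ofT (f26 x) :=
  (Monoid.PushoutI.of_apply_eq_base SL2ZMaps true x).symm

lemma push_ind {P : Monoid.PushoutI SL2ZMaps → Prop} (hs : ∀ n : ℕ, P (pS ^ n))
    (hu : ∀ n : ℕ, P (pU ^ n)) (hm : ∀ x y, P x → P y → P (x * y)) (g) : P g := by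
  refine Monoid.PushoutI.induction_on g ?_ ?_ hm
  · have h1 : ∀ x, P (ofF x) := fun x => by rw [ofF_eq]; exact hs _
    have h2 : ∀ x, P (ofT x) := fun x => by rw [ofT_eq]; exact hu _
    rintro (_ | _) x
    · exact h1 x
    · exact h2 x
  · intro h
    rw [base_eq, ofF_eq]; exact hs _

lemma pU_cube : pU ^ 3 = pS ^ 2 := by
  have h := (base_eq' (Multiplicative.ofAdd (1 : ZMod 2))).symm.trans
    (base_eq (Multiplicative.ofAdd (1 : ZMod 2)))
  rw [ofF_eq, ofT_eq] at h
  exact h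

lemma pS_four : pS ^ 4 = 1 := by
  unfold pS
  rw [← map_pow, show (Multiplicative.ofAdd (1 : ZMod 4)) ^ 4 = 1 by decide, map_one]

/-- Positive words. -/
inductive PosW : Monoid.PushoutI SL2ZMaps → Prop
  | one : PosW 1
  | a (w) : PosW w → PosW (pS * pU * w)
  | b (w) : PosW w → PosW (pS * pU ^ 2 * w)

/-- Normal forms. -/
def NF (g : Monoid.PushoutI SL2ZMaps) : Prop :=
  ∃ e i j : ℕ, ∃ w, e < 2 ∧ i < 3 ∧ j < 2 ∧ PosW w ∧ g = (pS ^ 2) ^ e * pU ^ i * w * pS ^ j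

lemma z_sq : (pS ^ 2) * (pS ^ 2) = 1 := by rw [← pow_add]; exact pS_four

lemma z_comm (g : Monoid.PushoutI SL2ZMaps) : Commute (pS ^ 2) g := by
  have hs : Commute (pS ^ 2) pS := (Commute.refl pS).pow_left 2
  have hu : Commute (pS ^ 2) pU := by
    rw [← pU_cube]; exact (Commute.refl pU).pow_left 3
  exact push_ind (fun n => hs.pow_right n) (fun n => hu.pow_right n)
    (fun _ _ hx hy => hx.mul_right hy) g

lemma NF_z {g} (h : NF g) : NF (pS ^ 2 * g) := by
  obtain ⟨e, i, j, w, he, hi, hj, hw, rfl⟩ := h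
  interval_cases e
  · exact ⟨1, i, j, w, by omega, hi, hj, hw, by simp [mul_assoc]⟩
  · refine ⟨0, i, j, w, by omega, hi, hj, hw, ?_⟩
    simp only [pow_one, pow_zero, one_mul, ← mul_assoc, z_sq]

lemma NF_ze {g} (e : ℕ) (h : NF g) : NF ((pS ^ 2) ^ e * g) := by
  induction e with
  | zero => simpa using h
  | succ n ih => rw [pow_succ', mul_assoc]; exact NF_z ih

lemma NF_u {g} (h : NF g) : NF (pU * g) := by
  obtain ⟨e, i, j, w, he, hi, hj, hw, rfl⟩ := h
  have : pU * ((pS ^ 2) ^ e * pU ^ i * w * pS ^ j) =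
      (pS ^ 2) ^ e * (pU ^ (i + 1) * w * pS ^ j) := by
    have := ((z_comm pU).pow_left e).eq
    rw [pow_succ' pU i]
    simp only [← mul_assoc, this]
  rw [this]
  apply NF_ze
  by_cases h2 : i = 2
  · subst h2
    rw [pU_cube, mul_assoc]
    apply NF_z
    exact ⟨0, 0, j, w, by omega, by omega, hj, hw, by simp [mul_assoc]⟩
  · exact ⟨0, i + 1, j, w, by omega, by omega, hj, hw, by simp [mul_assoc]⟩

lemma NF_s {g} (h : NF g) : NF (pS * g) := by
  obtain ⟨e, i, j, w, he, hi, hj, hw, rfl⟩ := h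
  have : pS * ((pS ^ 2) ^ e * pU ^ i * w * pS ^ j) =
      (pS ^ 2) ^ e * (pS * pU ^ i * w * pS ^ j) := by
    have := ((z_comm pS).pow_left e).eq
    simp only [← mul_assoc, this]
  rw [this]
  apply NF_ze
  interval_cases i
  · cases hw with
    | one =>
      interval_cases j
      · exact ⟨0, 0, 1, 1, by omega, by omega, by omega, .one, by simp⟩
      · exact ⟨1, 0, 0, 1, by omega, by omega, by omega, .one, by simp [pow_two]⟩
    | a w hw => exact ⟨1, 1, j, w, by omega, by omega, hj, hw, by simp [pow_two, mul_assoc]⟩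
    | b w hw => exact ⟨1, 2, j, w, by omega, by omega, hj, hw, by simp [pow_two, mul_assoc]⟩
  · exact ⟨0, 0, j, _, by omega, by omega, hj, .a w hw, by simp⟩
  · exact ⟨0, 0, j, _, by omega, by omega, hj, .b w hw, by simp⟩

lemma NF_all (g : Monoid.PushoutI SL2ZMaps) : NF g := by
  have hs : ∀ (n : ℕ) x, NF x → NF (pS ^ n * x) := by
    intro n x hx
    induction n with
    | zero => simpa using hx
    | succ n ih => rw [pow_succ', mul_assoc]; exact NF_s ih
  have hu : ∀ (n : ℕ) x, NF x → NF (pU ^ n * x) := by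
    intro n x hx
    induction n with
    | zero => simpa using hx
    | succ n ih => rw [pow_succ', mul_assoc]; exact NF_u ih
  have key : ∀ x, NF x → NF (g * x) := by
    refine push_ind (P := fun g => ∀ x, NF x → NF (g * x)) hs hu ?_ g
    intro x y hx hy t ht
    rw [mul_assoc]; exact hx _ (hy _ ht)
  have := key 1 ⟨0, 0, 0, 1, by omega, by omega, by omega, .one, by simp⟩
  simpa using this

lemma PosW_pos {w} (hw : PosW w) : ∃ σ : ℤ, (σ = 1 ∨ σ = -1) ∧
    ∃ a b c d : ℤ, (slPhi w).1 = σ • !![a, b; c, d] ∧ 0 ≤ a ∧ 0 ≤ b ∧ 0 ≤ c ∧ 0 ≤ d ∧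
      1 ≤ a + b ∧ 1 ≤ c + d ∧ (w = 1 ∨ 3 ≤ a + b + c + d) := by
  induction hw with
  | one =>
    refine ⟨1, .inl rfl, 1, 0, 0, 1, ?_, by simp⟩
    rw [map_one]; decide
  | a w hw ih =>
    obtain ⟨σ, hσ, a, b, c, d, h, ha, hb, hc, hd, h1, h2, -⟩ := ih
    refine ⟨-σ, by omega, a + c, b + d, c, d, ?_, by omega, by omega, by omega, by omega,
      by omega, by omega, .inr (by omega)⟩
    have e : (slS * slU).1 = !![-1, -1; 0, -1] := by decide
    rw [map_mul, map_mul, slPhi_pS, slPhi_pU, Matrix.SpecialLinearGroup.coe_mul, h, e]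
    ext i j
    fin_cases i <;> fin_cases j <;> simp [Matrix.mul_apply, Fin.sum_univ_two] <;> ring
  | b w hw ih =>
    obtain ⟨σ, hσ, a, b, c, d, h, ha, hb, hc, hd, h1, h2, -⟩ := ih
    refine ⟨-σ, by omega, a, b, a + c, b + d, ?_, by omega, by omega, by omega, by omega,
      by omega, by omega, .inr (by omega)⟩
    have e : (slS * slU ^ 2).1 = !![-1, 0; -1, -1] := by decide
    rw [map_mul, map_mul, map_pow, slPhi_pS, slPhi_pU, Matrix.SpecialLinearGroup.coe_mul, h, e]
    ext i j
    fin_cases i <;> fin_cases j <;> simp [Matrix.mul_apply, Fin.sum_univ_two] <;> ring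

lemma mixed : ∀ e : Fin 2, ∀ i : Fin 3, ∀ j : Fin 2, (i = 0 ∧ j = 0) ∨
    ∃ p q p' q' : Fin 2,
      (((slS ^ 2) ^ e.1 * slU ^ i.1)⁻¹ * (slS ^ j.1)⁻¹).1 p q < 0 ∧
      0 < (((slS ^ 2) ^ e.1 * slU ^ i.1)⁻¹ * (slS ^ j.1)⁻¹).1 p' q' := by decide

lemma slPhi_inj : Function.Injective slPhi := by
  rw [injective_iff_map_eq_one]
  intro g hg
  obtain ⟨e, i, j, w, he, hi, hj, hw, rfl⟩ := NF_all g
  obtain ⟨σ, hσ, a, b, c, d, h, ha, hb, hc, hd, h1, h2, h3⟩ := PosW_pos hw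
  simp only [map_mul, map_pow, slPhi_pS, slPhi_pU] at hg
  have hW : slPhi w = ((slS ^ 2) ^ e * slU ^ i)⁻¹ * (slS ^ j)⁻¹ := by
    rw [eq_mul_inv_iff_mul_eq, eq_comm, inv_eq_iff_mul_eq_one, ← mul_assoc]
    exact hg
  rcases mixed ⟨e, he⟩ ⟨i, hi⟩ ⟨j, hj⟩ with ⟨hi0, hj0⟩ | ⟨p, q, p', q', hn, hp⟩
  · obtain rfl : i = 0 := by simpa using hi0
    obtain rfl : j = 0 := by simpa using hj0
    have hsum : a + b + c + d = 2 := by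
      have key : ∀ e : Fin 2, (((slS ^ 2) ^ e.1 * slU ^ 0)⁻¹ * (slS ^ 0)⁻¹).1 0 1 = 0 ∧
          (((slS ^ 2) ^ e.1 * slU ^ 0)⁻¹ * (slS ^ 0)⁻¹).1 1 0 = 0 ∧
          |(((slS ^ 2) ^ e.1 * slU ^ 0)⁻¹ * (slS ^ 0)⁻¹).1 0 0| = 1 ∧
          |(((slS ^ 2) ^ e.1 * slU ^ 0)⁻¹ * (slS ^ 0)⁻¹).1 1 1| = 1 := by decide
      have := key ⟨e, he⟩
      rw [← hW, h] at this
      rcases hσ with rfl | rfl <;> simp [abs_of_nonneg, ha, hd] at this <;> omega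
    rcases h3 with rfl | h3
    · interval_cases e
      · simp
      · exfalso; revert hW; rw [map_one]; decide
    · omega
  · exfalso
    simp only [← hW, h] at hn hp
    have nn : ∀ p q, 0 ≤ !![a, b; c, d] p q := by
      intro p q
      fin_cases p <;> fin_cases q <;> simpa
    have n1 := nn p q
    have n2 := nn p' q'
    simp only [Matrix.smul_apply, smul_eq_mul] at hn hp
    rcases hσ with rfl | rfl <;> linarith

lemma slPhi_surj : Function.Surjective slPhi := by
  rw [← MonoidHom.range_eq_top, eq_top_iff, ← SpecialLinearGroup.SL2Z_generators,
    Subgroup.closure_le]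
  rintro x (rfl | rfl)
  · exact ⟨pS, by rw [slPhi_pS]; decide⟩
  · exact ⟨pS ^ 3 * pU, by rw [map_mul, map_pow, slPhi_pS, slPhi_pU]; decide⟩

/-- `SL₂(ℤ)` is the amalgamated free product `C₄ *_{C₂} C₆`: the maps `f24 : C₂ →* C₄` and
`f26 : C₂ →* C₆` are injective, send the generator to the unique element of order 2, and
`SL₂(ℤ)` is isomorphic to the pushout of `C₄ ← C₂ → C₆` in the category of groups. -/
theorem sl2z_amalgam :
    Function.Injective f24 ∧ Function.Injective f26 ∧
    f24 (Multiplicative.ofAdd (1 : ZMod 2)) = Multiplicative.ofAdd (2 : ZMod 4) ∧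
    f26 (Multiplicative.ofAdd (1 : ZMod 2)) = Multiplicative.ofAdd (3 : ZMod 6) ∧
    Nonempty (Matrix.SpecialLinearGroup (Fin 2) ℤ ≃* Monoid.PushoutI SL2ZMaps) := by
  refine ⟨by decide, by decide, by decide, by decide,
    ⟨(MulEquiv.ofBijective slPhi ⟨slPhi_inj, slPhi_surj⟩).symm⟩⟩
end

section
/- (Higman, 1961; existence of universal finitely presented groups.) There exists a finitely presented group U such that every finitely presented group embeds into U: there exist n : ℕ and a finite subset R of FreeGroup (Fin n) such that U is isomorphic to the quotient of FreeGroup (Fin n) by the normal closure of R, and for every group G that is isomorphic to a quotient of some FreeGroup (Fin m) by the normal closure of a finite subset, there is an injective group homomorphism G →* U. -/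
namespace UnivFP

/-- Simultaneous HNN extensions. -/
theorem hnn_many (J : Type) [Finite J] : ∀ (B S : Type) [Group B] [Group S] (p q : J → S →* B)
    (_ : ∀ j, Function.Injective (p j)) (_ : ∀ j, Function.Injective (q j)),
    ∃ (V : Type) (_ : Group V) (f : B →* V) (t : J → V), Function.Injective f ∧
      ∀ j s, t j * f (p j s) * (t j)⁻¹ = f (q j s) := by
  refine Finite.induction_empty_option (P := fun J : Type =>
    ∀ (B S : Type) [Group B] [Group S] (p q : J → S →* B)
    (_ : ∀ j, Function.Injective (p j)) (_ : ∀ j, Function.Injective (q j)),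
    ∃ (V : Type) (_ : Group V) (f : B →* V) (t : J → V), Function.Injective f ∧
      ∀ j s, t j * f (p j s) * (t j)⁻¹ = f (q j s)) ?_ ?_ ?_ J
  · intro α β e h B S _ _ p q hp hq
    obtain ⟨V, _, f, t, hf, ht⟩ := h B S (fun a => p (e a)) (fun a => q (e a))
      (fun a => hp _) (fun a => hq _)
    refine ⟨V, _, f, fun b => t (e.symm b), hf, fun j s => ?_⟩
    have := ht (e.symm j) s
    simpa using this
  · intro B S _ _ p q _ _
    exact ⟨B, _, MonoidHom.id B, fun j => j.elim, fun _ _ h => h, fun j => j.elim⟩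
  · intro α _ h B S _ _ p q hp hq
    obtain ⟨V, _, f, t, hf, ht⟩ := h B S (fun a => p (some a)) (fun a => q (some a))
      (fun a => hp _) (fun a => hq _)
    let P : S →* V := f.comp (p none)
    let Q : S →* V := f.comp (q none)
    have hP : Function.Injective P := hf.comp (hp none)
    have hQ : Function.Injective Q := hf.comp (hq none)
    let φ : P.range ≃* Q.range :=
      (MonoidHom.ofInjective hP).symm.trans (MonoidHom.ofInjective hQ)
    refine ⟨HNNExtension V P.range Q.range φ, inferInstance, HNNExtension.of.comp f,
      fun j => j.elim HNNExtension.t (fun a => HNNExtension.of (t a)),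
      fun _ _ h => hf (HNNExtension.of_injective _ h), ?_⟩
    rintro (_ | a) s
    · have h1 := HNNExtension.equiv_eq_conj (φ := φ) (MonoidHom.ofInjective hP s)
      have h2 : φ (MonoidHom.ofInjective hP s) = MonoidHom.ofInjective hQ s := by
        simp [φ]
      rw [h2] at h1
      exact h1.symm
    · change HNNExtension.of (t a) * HNNExtension.of (f (p (some a) s)) *
        (HNNExtension.of (t a))⁻¹ = HNNExtension.of (f (q (some a) s))
      rw [← map_mul, ← map_inv, ← map_mul, ht]

/-- Normal closure of `R` under the endomorphisms `θ`. -/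
inductive LN {α I : Type} (R : Set (FreeGroup α)) (θ : I → FreeGroup α →* FreeGroup α) :
    FreeGroup α → Prop
  | rel (r) : r ∈ R → LN R θ r
  | one : LN R θ 1
  | mul (a b) : LN R θ a → LN R θ b → LN R θ (a * b)
  | inv (a) : LN R θ a → LN R θ a⁻¹
  | conj (a g) : LN R θ a → LN R θ (g * a * g⁻¹)
  | th (i a) : LN R θ a → LN R θ (θ i a)

def LNs {α I : Type} (R : Set (FreeGroup α)) (θ : I → FreeGroup α →* FreeGroup α) :
    Subgroup (FreeGroup α) where
  carrier := {a | LN R θ a}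
  one_mem' := LN.one
  mul_mem' := fun {a b} ha hb => LN.mul a b ha hb
  inv_mem' := fun {a} ha => LN.inv a ha

instance {α I : Type} (R : Set (FreeGroup α)) (θ : I → FreeGroup α →* FreeGroup α) :
    (LNs R θ).Normal := ⟨fun a ha g => LN.conj a g ha⟩

theorem mem_LNs {α I : Type} {R : Set (FreeGroup α)} {θ : I → FreeGroup α →* FreeGroup α}
    {a : FreeGroup α} : a ∈ LNs R θ ↔ LN R θ a := Iff.rfl

section T
variable {α I : Type} (R : Set (FreeGroup α)) (θ : I → FreeGroup α →* FreeGroup α)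

abbrev Bt (α I : Type) := (α ⊕ α) ⊕ Option I

def Y1 : FreeGroup α →* FreeGroup (Bt α I) := FreeGroup.map (fun a => Sum.inl (Sum.inl a))
def Y2 : FreeGroup α →* FreeGroup (Bt α I) := FreeGroup.map (fun a => Sum.inl (Sum.inr a))
def tt (i : Option I) : FreeGroup (Bt α I) := FreeGroup.of (Sum.inr i)

def RR : Set (FreeGroup (Bt α I)) :=
  (Y1 '' R) ∪ (Set.range (fun x : α × α => Y1 (FreeGroup.of x.1) * Y2 (FreeGroup.of x.2) *
      (Y1 (FreeGroup.of x.1))⁻¹ * (Y2 (FreeGroup.of x.2))⁻¹))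
  ∪ (Set.range (fun x : I × α => tt (some x.1) * Y1 (FreeGroup.of x.2) * (tt (some x.1))⁻¹ *
      (Y1 (FreeGroup.of x.2) * Y2 (θ x.1 (FreeGroup.of x.2)))⁻¹))
  ∪ (Set.range (fun a : α => tt none * Y2 (FreeGroup.of a) * (tt none)⁻¹ *
      (Y1 (FreeGroup.of a))⁻¹))

theorem RR_finite [Finite α] [Finite I] (hR : R.Finite) : (RR R θ).Finite :=
  (((hR.image _).union (Set.finite_range _)).union (Set.finite_range _)).union
    (Set.finite_range _)

theorem comm_of_gens {β G : Type} [Group G] {f : FreeGroup β →* G} {g : G}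
    (h : ∀ b, Commute (f (FreeGroup.of b)) g) (u : FreeGroup β) : Commute (f u) g := by
  induction u using FreeGroup.induction_on with
  | C1 => simp
  | of b => exact h b
  | inv_of b hb => rw [map_inv]; exact hb.inv_left
  | mul a b ha hb => rw [map_mul]; exact ha.mul_left hb

/-- If `f` and `g` have commuting images, and `h` is their product on generators, then
everywhere. -/
theorem hom_mul {β G : Type} [Group G] {f g h : FreeGroup β →* G}
    (hc : ∀ a b, Commute (f (FreeGroup.of a)) (g (FreeGroup.of b)))
    (hh : ∀ a, h (FreeGroup.of a) = f (FreeGroup.of a) * g (FreeGroup.of a))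
    (u : FreeGroup β) : h u = f u * g u := by
  have hc' : ∀ u v, Commute (f u) (g v) := fun u v =>
    comm_of_gens (fun a => (comm_of_gens (fun b => (hc a b).symm) v).symm) u
  induction u using FreeGroup.induction_on with
  | C1 => simp
  | of b => exact hh b
  | inv_of b hb => rw [map_inv, hb, map_inv, map_inv, mul_inv_rev, ← mul_inv_rev, ← mul_inv_rev,
      (hc' _ _).eq]
  | mul a b ha hb =>
    rw [map_mul, ha, hb, map_mul, map_mul]
    have := (hc' b a).eq
    simp only [mul_assoc]
    rw [← mul_assoc (g a), ← this, mul_assoc]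

theorem thmT [Finite I] :
    ∃ η : FreeGroup α →* PresentedGroup (RR R θ), ∀ u, η u = 1 ↔ LN R θ u := by
  let π : FreeGroup (Bt α I) →* PresentedGroup (RR R θ) := PresentedGroup.mk _
  have hπ : ∀ r ∈ RR R θ, π r = 1 := fun r hr =>
    (PresentedGroup.one_of_mem hr)
  refine ⟨π.comp Y1, fun u => ⟨fun hu => ?_, fun hu => ?_⟩⟩
  · -- model
    let N := LNs R θ
    let θb : I → (FreeGroup α ⧸ N) →* (FreeGroup α ⧸ N) := fun i =>
      QuotientGroup.map N N (θ i) (fun a ha => LN.th i a ha)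
    let p : Option I → (FreeGroup α ⧸ N) →* (FreeGroup α ⧸ N) × (FreeGroup α ⧸ N) :=
      fun j => j.elim (MonoidHom.inr _ _) (fun _ => MonoidHom.inl _ _)
    let q : Option I → (FreeGroup α ⧸ N) →* (FreeGroup α ⧸ N) × (FreeGroup α ⧸ N) :=
      fun j => j.elim (MonoidHom.inl _ _) (fun i => (MonoidHom.id _).prod (θb i))
    obtain ⟨V, _, f, t, hf, ht⟩ := hnn_many (Option I) _ _ p q (by
      rintro (_ | j) x y h
      · exact congrArg Prod.snd h
      · exact congrArg Prod.fst h) (by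
      rintro (_ | j) x y h
      · exact congrArg Prod.fst h
      · exact congrArg Prod.fst h)
    let g0 : Bt α I → V := Sum.elim (Sum.elim
      (fun a => f (QuotientGroup.mk (FreeGroup.of a), 1))
      (fun a => f (1, QuotientGroup.mk (FreeGroup.of a)))) t
    let i1 : FreeGroup α →* V := f.comp ((MonoidHom.inl _ _).comp (QuotientGroup.mk' N))
    let i2 : FreeGroup α →* V := f.comp ((MonoidHom.inr _ _).comp (QuotientGroup.mk' N))
    have e1 : ∀ u, FreeGroup.lift g0 (Y1 u) = i1 u := by
      intro u
      have : (FreeGroup.lift g0).comp Y1 = i1 := by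
        ext a; simp [Y1, g0, i1]
      exact DFunLike.congr_fun this u
    have e2 : ∀ u, FreeGroup.lift g0 (Y2 u) = i2 u := by
      intro u
      have : (FreeGroup.lift g0).comp Y2 = i2 := by
        ext a; simp [Y2, g0, i2]
      exact DFunLike.congr_fun this u
    have e3 : ∀ i, FreeGroup.lift g0 (tt i) = t i := by
      intro i; simp [tt, g0]
    have hrel : ∀ r ∈ RR R θ, FreeGroup.lift g0 r = 1 := by
      rintro r (((⟨r, hr, rfl⟩ | ⟨⟨a, b⟩, rfl⟩) | ⟨⟨i, a⟩, rfl⟩) | ⟨a, rfl⟩)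
      · rw [e1]
        have : (QuotientGroup.mk' N) r = 1 := (QuotientGroup.eq_one_iff r).2 (LN.rel r hr)
        change f ((QuotientGroup.mk' N) r, 1) = 1
        rw [this]; exact map_one f
      · simp only [map_mul, map_inv, e1, e2]
        simp only [i1, i2, MonoidHom.comp_apply, ← map_mul, ← map_inv]
        rw [← map_one f]
        congr 1
        simp
      · simp only [map_mul, map_inv, e1, e2, e3]
        have := ht (some i) (QuotientGroup.mk (FreeGroup.of a))
        rw [mul_inv_eq_one]
        refine this.trans ?_
        simp only [i1, i2, MonoidHom.comp_apply, ← map_mul]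
        congr 1
        simp [q, θb]
        rfl
      · simp only [map_mul, map_inv, e1, e2, e3]
        have := ht none (QuotientGroup.mk (FreeGroup.of a))
        rw [mul_inv_eq_one]
        exact this
    have key : PresentedGroup.toGroup hrel (π (Y1 u)) = i1 u := by
      rw [← e1]; rfl
    rw [MonoidHom.comp_apply] at hu
    rw [hu, map_one] at key
    have h1 := hf (key.symm.trans (map_one f).symm)
    have h2 : (QuotientGroup.mk' N) u = 1 := congrArg Prod.fst h1
    exact (QuotientGroup.eq_one_iff u).1 h2
  · have c12 : ∀ a b, Commute (π (Y1 (FreeGroup.of a))) (π (Y2 (FreeGroup.of b))) := by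
      intro a b
      have := hπ _ (Or.inl (Or.inl (Or.inr ⟨(a, b), rfl⟩)))
      simp only [map_mul, map_inv] at this
      rw [mul_inv_eq_one, mul_inv_eq_iff_eq_mul] at this
      exact this
    have c12' : ∀ a v, Commute (π (Y1 (FreeGroup.of a))) (π (Y2 v)) := fun a v =>
      (comm_of_gens (f := π.comp Y2) (fun b => (c12 a b).symm) v).symm
    have back : ∀ u, π (tt none) * π (Y2 u) * (π (tt none))⁻¹ = π (Y1 u) := by
      intro u
      have : ((MulAut.conj (π (tt none))).toMonoidHom.comp (π.comp Y2)) = π.comp Y1 := by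
        ext a
        have := hπ _ (Or.inr ⟨a, rfl⟩)
        simp only [map_mul, map_inv] at this
        rw [mul_inv_eq_one] at this
        simpa using this
      exact DFunLike.congr_fun this u
    have step : ∀ i u, π (tt (some i)) * π (Y1 u) * (π (tt (some i)))⁻¹ =
        π (Y1 u) * π (Y2 (θ i u)) := by
      intro i u
      refine hom_mul (f := π.comp Y1) (g := (π.comp Y2).comp (θ i))
        (h := (MulAut.conj (π (tt (some i)))).toMonoidHom.comp (π.comp Y1)) ?_ ?_ u
      · intro a b; exact c12' _ _
      · intro a
        have := hπ _ (Or.inl (Or.inr ⟨(i, a), rfl⟩))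
        simp only [map_mul, map_inv] at this
        rw [mul_inv_eq_one] at this
        simpa using this
    induction hu with
    | rel r hr => exact hπ _ (Or.inl (Or.inl (Or.inl ⟨r, hr, rfl⟩)))
    | one => simp
    | mul a b _ _ ha hb => rw [map_mul, ha, hb, mul_one]
    | inv a _ ha => rw [map_inv, ha, inv_one]
    | conj a g _ ha => rw [map_mul, map_mul, ha, map_inv]; simp
    | th i a _ ha =>
      rw [MonoidHom.comp_apply] at ha ⊢
      have h1 := step i a
      rw [ha] at h1
      rw [← back, ← one_mul (π (Y2 _)), ← h1]
      simp
end T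

/-- Reduction to four generators. -/
theorem four_gen (n : ℕ) (R : Set (FreeGroup (Fin n))) :
    ∃ ζ : FreeGroup (Fin n) →* FreeGroup (Fin 4), ∀ u,
      ζ u ∈ Subgroup.normalClosure (ζ '' R) → u ∈ Subgroup.normalClosure R := by
  let w (a b : Fin 4) (i : ℕ) : FreeGroup (Fin 4) :=
    (FreeGroup.of b) ^ i * FreeGroup.of a * ((FreeGroup.of b) ^ i)⁻¹
  let ζ : FreeGroup (Fin n) →* FreeGroup (Fin 4) :=
    FreeGroup.lift (fun i => w 0 1 i * (w 2 3 i)⁻¹)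
  refine ⟨ζ, fun u hu => ?_⟩
  let H := FreeGroup (Fin n) ⧸ Subgroup.normalClosure R
  let h : ℕ → H := fun i => if hi : i < n then QuotientGroup.mk (FreeGroup.of ⟨i, hi⟩) else 1
  let y : Bool → ℕ → H × FreeGroup ℕ := fun b i =>
    (if b then 1 else (h i)⁻¹, FreeGroup.of i)
  let p : Bool → FreeGroup ℕ →* H × FreeGroup ℕ := fun b => FreeGroup.lift (y b)
  let q : Bool → FreeGroup ℕ →* H × FreeGroup ℕ := fun b => FreeGroup.lift (fun i => y b (i + 1))
  obtain ⟨V, _, f, t, hf, ht⟩ := hnn_many Bool _ _ p q (by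
    intro b
    have : (MonoidHom.snd H (FreeGroup ℕ)).comp (p b) = MonoidHom.id _ := by
      ext i; simp [p, y]
    refine Function.Injective.of_comp (f := MonoidHom.snd H (FreeGroup ℕ)) ?_
    rw [← MonoidHom.coe_comp, this]; exact fun _ _ h => h) (by
    intro b
    have : (MonoidHom.snd H (FreeGroup ℕ)).comp (q b) = FreeGroup.map (fun i => i + 1) := by
      ext i; simp [q, y]
    refine Function.Injective.of_comp (f := MonoidHom.snd H (FreeGroup ℕ)) ?_
    rw [← MonoidHom.coe_comp, this]
    exact FreeGroup.map_injective (add_left_injective 1))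
  have hs : ∀ b i, t b * f (y b i) * (t b)⁻¹ = f (y b (i + 1)) := by
    intro b i
    have := ht b (FreeGroup.of i)
    simpa [p, q] using this
  have hpow : ∀ b i, (t b) ^ i * f (y b 0) * ((t b) ^ i)⁻¹ = f (y b i) := by
    intro b i
    induction i with
    | zero => simp
    | succ i ih =>
      rw [← hs, ← ih, pow_succ']; simp [mul_assoc]
  let g : FreeGroup (Fin 4) →* V :=
    FreeGroup.lift ![f (y true 0), t true, f (y false 0), t false]
  have hg : ∀ u, g (ζ u) = f (QuotientGroup.mk u, 1) := by
    intro u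
    have : g.comp ζ = f.comp ((MonoidHom.inl _ _).comp (QuotientGroup.mk' _)) := by
      ext i
      have h1 := hpow true i
      have h2 := hpow false i
      have hz : g (ζ (FreeGroup.of i)) = f (y true i) * (f (y false i))⁻¹ := by
        rw [← h1, ← h2]
        simp [g, ζ, w]
      refine hz.trans ?_
      rw [← map_inv, ← map_mul]
      simp [y, h]
      rw [inv_inv]; rfl
    exact DFunLike.congr_fun this u
  have hker : Subgroup.normalClosure (ζ '' R) ≤ g.ker := by
    refine Subgroup.normalClosure_le_normal ?_
    rintro _ ⟨r, hr, rfl⟩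
    change g (ζ r) = 1
    rw [hg]
    have : (QuotientGroup.mk r : H) = 1 :=
      (QuotientGroup.eq_one_iff r).2 (Subgroup.subset_normalClosure hr)
    rw [this]; exact map_one f
  have h1 : g (ζ u) = 1 := hker hu
  rw [hg] at h1
  have h2 := hf (h1.trans (map_one f).symm)
  exact (QuotientGroup.eq_one_iff u).1 (congrArg Prod.fst h2)

section Machine
variable (ι : Type)

/-- Code letters. -/
abbrev Cd := Option (ι × Bool)
/-- Symbols: `x i`, `f`, `g`. -/
abbrev Sy := ι ⊕ Bool
/-- Generators. -/
abbrev Gn := ((Bool × Sy ι) ⊕ (Bool × Cd ι)) ⊕ (Unit ⊕ Cd ι)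

variable {ι}

def ee (b : Bool) (c : Cd ι) : FreeGroup (Gn ι) := FreeGroup.of (Sum.inl (Sum.inr (b, c)))
def kk : FreeGroup (Gn ι) := FreeGroup.of (Sum.inr (Sum.inl ()))
def ek (c : Cd ι) : FreeGroup (Gn ι) := FreeGroup.of (Sum.inr (Sum.inr c))
def cls (b : Bool) : FreeGroup (Sy ι) →* FreeGroup (Gn ι) :=
  FreeGroup.map (fun s => Sum.inl (Sum.inl (b, s)))

def sx (i : ι) : FreeGroup (Sy ι) := FreeGroup.of (Sum.inl i)
def sf : FreeGroup (Sy ι) := FreeGroup.of (Sum.inr true)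
def sg : FreeGroup (Sy ι) := FreeGroup.of (Sum.inr false)

/-- signed letter -/
def sgn {G : Type} [Group G] (x : G) (b : Bool) : G := if b then x else x⁻¹

def psi : Option (Cd ι) → FreeGroup (Sy ι) →* FreeGroup (Sy ι)
  | none => FreeGroup.lift (Sum.elim sx (fun _ => sf))
  | some none => MonoidHom.id _
  | some (some (j, b)) =>
      FreeGroup.lift (Sum.elim sx (fun d => if d then sgn (sx j) b * sf else sg))

def cod : Option (Cd ι) → Cd ι
  | none => none
  | some c => c

def theta (i : Option (Cd ι)) : FreeGroup (Gn ι) →* FreeGroup (Gn ι) :=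
  FreeGroup.lift (Sum.elim
    (Sum.elim (fun x => ee x.1 (cod i) * cls x.1 (psi i (FreeGroup.of x.2)) * (ee x.1 (cod i))⁻¹)
      (fun x => ee x.1 x.2))
    (Sum.elim (fun _ => ek (cod i) * kk * (ek (cod i))⁻¹) ek))

def Pe (b : Bool) : List (Cd ι) → FreeGroup (Gn ι)
  | [] => 1
  | c :: w => Pe b w * ee b c

def Pk : List (Cd ι) → FreeGroup (Gn ι)
  | [] => 1
  | c :: w => Pk w * ek c

def att (b : Bool) (w : List (Cd ι)) : FreeGroup (Sy ι) →* FreeGroup (Gn ι) :=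
  (MulAut.conj (Pe b w)).toMonoidHom.comp (cls b)

def kat (w : List (Cd ι)) : FreeGroup (Gn ι) := Pk w * kk * (Pk w)⁻¹

theorem att_apply (b : Bool) (w : List (Cd ι)) (u) :
    att b w u = Pe b w * cls b u * (Pe b w)⁻¹ := rfl

theorem theta_ee (i b) (c : Cd ι) : theta i (ee b c) = ee b c := by
  simp [theta, ee]
theorem theta_ek (i) (c : Cd ι) : theta i (ek c) = ek c := by
  simp [theta, ek]
theorem theta_kk (i) : theta i (kk : FreeGroup (Gn ι)) = ek (cod i) * kk * (ek (cod i))⁻¹ := by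
  simp [theta, kk]
theorem theta_cls (i b) (u : FreeGroup (Sy ι)) :
    theta i (cls b u) = ee b (cod i) * cls b (psi i u) * (ee b (cod i))⁻¹ := by
  have : (theta i).comp (cls b) =
      (MulAut.conj (ee b (cod i))).toMonoidHom.comp ((cls b).comp (psi i)) := by
    ext s
    simp [theta, cls]
  exact DFunLike.congr_fun this u
theorem theta_Pe (i b) (w : List (Cd ι)) : theta i (Pe b w) = Pe b w := by
  induction w with
  | nil => simp [Pe]
  | cons c w ih => simp [Pe, ih, theta_ee]
theorem theta_Pk (i) (w : List (Cd ι)) : theta i (Pk w) = Pk w := by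
  induction w with
  | nil => simp [Pk]
  | cons c w ih => simp [Pk, ih, theta_ek]
theorem theta_att (i b) (w : List (Cd ι)) (u) :
    theta i (att b w u) = att b (cod i :: w) (psi i u) := by
  rw [att_apply, map_mul, map_mul, map_inv, theta_Pe, theta_cls, att_apply, Pe]
  simp [mul_assoc]
theorem theta_kat (i) (w : List (Cd ι)) : theta i (kat w) = kat (cod i :: w) := by
  rw [kat, map_mul, map_mul, map_inv, theta_Pk, theta_kk, kat, Pk]
  simp [mul_assoc]

theorem psi_x (i : Option (Cd ι)) (j : ι) : psi i (sx j) = sx j := by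
  rcases i with _ | _ | ⟨a, b⟩ <;> simp [psi, sx]

theorem psi_g (c : Cd ι) : psi (some c) sg = sg := by
  rcases c with _ | ⟨a, b⟩ <;> simp [psi, sg]

/-- `z_i` at `w` -/
def zat (w : List (Cd ι)) (i : ι) : FreeGroup (Gn ι) :=
  (att true w (sx i))⁻¹ * (kat w * att true w (sx i) * (kat w)⁻¹)

/-- Static words. -/
def st1 (w : List (Cd ι)) (i : ι) : FreeGroup (Gn ι) :=
  kat w * att false w (sx i) * (kat w)⁻¹ * (att false w (sx i))⁻¹
def st2 (w : List (Cd ι)) (x : ι × ι) : FreeGroup (Gn ι) :=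
  att true w (sx x.1) * zat w x.2 * (att true w (sx x.1))⁻¹ * (zat w x.2)⁻¹
def dyn (w : List (Cd ι)) (u : FreeGroup (Sy ι)) : FreeGroup (Gn ι) :=
  att true w u * (att false w u)⁻¹

def seeds (ι : Type) : Set (FreeGroup (Gn ι)) :=
  ({dyn [] sf, dyn [] sg} ∪ Set.range (st1 [])) ∪ Set.range (st2 [])

theorem seeds_finite [Finite ι] : (seeds ι).Finite :=
  (((Set.finite_singleton _).insert _).union (Set.finite_range _)).union (Set.finite_range _)

theorem theta_st1 (i) (w : List (Cd ι)) (j) : theta i (st1 w j) = st1 (cod i :: w) j := by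
  simp only [st1, map_mul, map_inv, theta_kat, theta_att, psi_x]
theorem theta_zat (i) (w : List (Cd ι)) (j) : theta i (zat w j) = zat (cod i :: w) j := by
  simp only [zat, map_mul, map_inv, theta_kat, theta_att, psi_x]
theorem theta_st2 (i) (w : List (Cd ι)) (j) : theta i (st2 w j) = st2 (cod i :: w) j := by
  simp only [st2, map_mul, map_inv, theta_zat, theta_att, psi_x]
theorem theta_dyn (i) (w : List (Cd ι)) (u) :
    theta i (dyn w u) = dyn (cod i :: w) (psi i u) := by
  simp only [dyn, map_mul, map_inv, theta_att]

/-! Lower bound: derivations. -/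

abbrev NN (a : FreeGroup (Gn ι)) : Prop := LN (seeds ι) theta a

theorem nn_st1 (w : List (Cd ι)) (j) : NN (st1 w j) := by
  induction w with
  | nil => exact LN.rel _ (Or.inl (Or.inr ⟨j, rfl⟩))
  | cons c w ih => have := LN.th (some c) _ ih; rwa [theta_st1] at this
theorem nn_st2 (w : List (Cd ι)) (j) : NN (st2 w j) := by
  induction w with
  | nil => exact LN.rel _ (Or.inr ⟨j, rfl⟩)
  | cons c w ih => have := LN.th (some c) _ ih; rwa [theta_st2] at this
theorem nn_g (w : List (Cd ι)) : NN (dyn w sg) := by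
  induction w with
  | nil => exact LN.rel _ (Or.inl (Or.inl (Or.inr rfl)))
  | cons c w ih => have := LN.th (some c) _ ih; rwa [theta_dyn, psi_g] at this
theorem nn_f (w : List (Cd ι)) : NN (dyn (none :: w) sf) := by
  have := LN.th none _ (nn_g w)
  rw [theta_dyn] at this
  simpa [psi, sg, cod] using this

def xem : FreeGroup ι →* FreeGroup (Sy ι) := FreeGroup.map Sum.inl

theorem psi_xem (i : Option (Cd ι)) (v) : psi i (xem v) = xem v := by
  have : (psi i).comp xem = xem := by
    ext j
    have := psi_x i j
    simpa [xem, sx] using this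
  exact DFunLike.congr_fun this v

def enc : List (ι × Bool) → List (Cd ι) → List (Cd ι)
  | [], w => w
  | c :: L, w => enc L (some c :: w)

def code : List (List (ι × Bool)) → List (Cd ι)
  | [] => [none]
  | L :: Ls => none :: enc L (code Ls)

theorem nn_step (c : Cd ι) (w : List (Cd ι)) (v) (h : NN (dyn w (xem v))) :
    NN (dyn (c :: w) (xem v)) := by
  have := LN.th (some c) _ h
  rwa [theta_dyn, psi_xem] at this

theorem nn_enc (L : List (ι × Bool)) : ∀ (w : List (Cd ι)) (v) (_ : NN (dyn w (xem v))),
    NN (dyn (enc L w) (xem v)) := by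
  induction L with
  | nil => intro w v h; exact h
  | cons c L ih => intro w v h; exact ih _ _ (nn_step _ _ _ h)

theorem mk_cons (c : ι × Bool) (L : List (ι × Bool)) :
    FreeGroup.mk (c :: L) = sgn (FreeGroup.of c.1) c.2 * FreeGroup.mk L := by
  obtain ⟨j, b⟩ := c
  cases b <;> simp [sgn, FreeGroup.of, FreeGroup.inv_mk, FreeGroup.mul_mk, FreeGroup.invRev]

theorem map_sgn {G H : Type} [Group G] [Group H] (f : G →* H) (x : G) (b : Bool) :
    f (sgn x b) = sgn (f x) b := by
  cases b <;> simp [sgn]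

theorem nn_run (L : List (ι × Bool)) : ∀ (w : List (Cd ι)) (v) (_ : NN (dyn w (xem v * sf))),
    NN (dyn (enc L w) (xem (v * FreeGroup.mk L) * sf)) := by
  induction L with
  | nil => intro w v h; simpa [enc, ← FreeGroup.one_eq_mk] using h
  | cons c L ih =>
    intro w v h
    have h1 := LN.th (some (some c)) _ h
    rw [theta_dyn, map_mul, psi_xem] at h1
    have h2 : psi (some (some c)) sf = xem (sgn (FreeGroup.of c.1) c.2) * sf := by
      rw [map_sgn]
      obtain ⟨j, b⟩ := c
      simp [psi, sf, xem, sx]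
    rw [h2, ← mul_assoc, ← map_mul] at h1
    have h3 := ih _ _ h1
    rw [mk_cons, ← mul_assoc]
    exact h3

theorem nn_dyn_mul_right {w : List (Cd ι)} {u v} (h1 : NN (dyn w (u * v))) (h2 : NN (dyn w v)) :
    NN (dyn w u) := by
  have := LN.mul _ _ h1 (LN.conj _ (att false w u) (LN.inv _ h2))
  convert this using 1
  simp [dyn, mul_assoc]

theorem nn_code_f (Ls : List (List (ι × Bool))) : NN (dyn (code Ls) (sf)) := by
  cases Ls <;> exact nn_f _

theorem nn_code (Ls : List (List (ι × Bool))) : ∀ L ∈ Ls,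
    NN (dyn (code Ls) (xem (FreeGroup.mk L))) := by
  induction Ls with
  | nil => intro L hL; simp at hL
  | cons L0 Ls ih =>
    intro L hL
    rcases List.mem_cons.1 hL with rfl | hL
    · have h0 : NN (dyn (code Ls) (xem 1 * sf)) := by simpa using nn_code_f Ls
      have h1 := nn_run L _ _ h0
      rw [one_mul] at h1
      have h2 := LN.th (some none) _ h1
      rw [theta_dyn] at h2
      exact nn_dyn_mul_right h2 (nn_f _)
    · exact nn_step _ _ _ (nn_enc _ _ _ (ih L hL))

/-- The rope trick. -/
theorem nn_rope (w : List (Cd ι)) (v : FreeGroup ι) (h : NN (dyn w (xem v))) :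
    NN (FreeGroup.lift (zat w) v) := by
  change FreeGroup.lift (zat w) v ∈ LNs (seeds ι) theta
  set π := QuotientGroup.mk' (LNs (seeds ι) theta) with hπ
  have hN : ∀ a, NN a → π a = 1 := fun a ha => (QuotientGroup.eq_one_iff a).2 ha
  refine (QuotientGroup.eq_one_iff _).1 ?_
  change π _ = 1
  have key := hom_mul (f := π.comp ((att true w).comp xem)) (g := π.comp (FreeGroup.lift (zat w)))
    (h := (MulAut.conj (π (kat w))).toMonoidHom.comp (π.comp ((att true w).comp xem))) ?_ ?_ v
  · have e1 : π (att true w (xem v)) = π (att false w (xem v)) := by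
      have := hN _ h
      rwa [dyn, map_mul, map_inv, mul_inv_eq_one] at this
    have e2 : Commute (π (att false w (xem v))) (π (kat w)) := by
      refine comm_of_gens (f := π.comp ((att false w).comp xem)) (fun j => ?_) v
      have := hN _ (nn_st1 w j)
      rw [st1, map_mul, map_mul, map_mul, map_inv, map_inv, mul_inv_eq_one,
        mul_inv_eq_iff_eq_mul] at this
      exact this.symm
    simp only [MonoidHom.comp_apply, e1] at key
    have e3 : (MulAut.conj (π (kat w))).toMonoidHom (π (att false w (xem v))) =
        π (att false w (xem v)) := by
      change π (kat w) * _ * (π (kat w))⁻¹ = _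
      rw [← e2.eq, mul_inv_cancel_right]
    rw [e3] at key
    exact (mul_eq_left.1 key.symm)
  · intro a b
    have := hN _ (nn_st2 w (a, b))
    rw [st2, map_mul, map_mul, map_mul, map_inv, map_inv, mul_inv_eq_one,
        mul_inv_eq_iff_eq_mul] at this
    simp only [MonoidHom.comp_apply, FreeGroup.lift_apply_of]
    exact this
  · intro a
    simp only [MonoidHom.comp_apply, FreeGroup.lift_apply_of, zat, ← map_mul]
    simp [xem, sx]

/-! Upper bound. -/

inductive Rel : List (Cd ι) → FreeGroup (Sy ι) → Prop
  | f0 : Rel [] sf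
  | g0 : Rel [] sg
  | step (i w u) : Rel w u → Rel (cod i :: w) (psi i u)

structure Good {W : Type} [Group W] (g : FreeGroup (Gn ι) →* W) : Prop where
  h1 : ∀ w j, g (st1 w j) = 1
  h2 : ∀ w j, g (st2 w j) = 1
  h3 : ∀ w u, Rel w u → g (dyn w u) = 1

theorem good_kills {W : Type} [Group W] {a : FreeGroup (Gn ι)} (ha : NN a) :
    ∀ g : FreeGroup (Gn ι) →* W, Good g → g a = 1 := by
  induction ha with
  | rel r hr =>
    intro g hg
    rcases hr with ((rfl | rfl) | ⟨j, rfl⟩) | ⟨j, rfl⟩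
    · exact hg.h3 _ _ Rel.f0
    · exact hg.h3 _ _ Rel.g0
    · exact hg.h1 _ _
    · exact hg.h2 _ _
  | one => intro g _; simp
  | mul a b _ _ ha hb => intro g hg; rw [map_mul, ha g hg, hb g hg, mul_one]
  | inv a _ ha => intro g hg; rw [map_inv, ha g hg, inv_one]
  | conj a b _ ha => intro g hg; rw [map_mul, map_mul, ha g hg, map_inv]; simp
  | th i a _ ha =>
    intro g hg
    refine ha (g.comp (theta i)) ⟨fun w j => ?_, fun w j => ?_, fun w u h => ?_⟩
    · rw [MonoidHom.comp_apply, theta_st1]; exact hg.h1 _ _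
    · rw [MonoidHom.comp_apply, theta_st2]; exact hg.h2 _ _
    · rw [MonoidHom.comp_apply, theta_dyn]; exact hg.h3 _ _ (Rel.step i _ _ h)

section Model
variable {H : Type} [Group H] (h : ι → H)

def phi : List (Cd ι) → H
  | [] => 1
  | none :: _ => 1
  | some (j, b) :: w => (sgn (h j) b)⁻¹ * phi w

def Valid : List (Cd ι) → Prop
  | [] => True
  | none :: w => Valid w ∧ phi h w = 1
  | some _ :: w => Valid w

def ev (φ : H) : FreeGroup (Sy ι) →* H :=
  FreeGroup.lift (Sum.elim h (fun d => if d then φ else 1))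

theorem rel_ev {w : List (Cd ι)} {u} (hr : Rel w u) : Valid h w → ev h (phi h w) u = 1 := by
  induction hr with
  | f0 => intro _; simp [ev, sf, phi]
  | g0 => intro _; simp [ev, sg]
  | step i w u _ ih =>
    intro hv
    have : Valid h w ∧ (ev h (phi h (cod i :: w))).comp (psi i) = ev h (phi h w) := by
      rcases i with _ | _ | ⟨j, b⟩
      · obtain ⟨h1, h2⟩ := hv
        refine ⟨h1, ?_⟩
        ext s
        rcases s with s | s | s <;> simp [ev, psi, cod, phi, h2, sx, sf]
      · obtain ⟨h1, h2⟩ := hv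
        refine ⟨h1, ?_⟩
        ext s
        rcases s with s | s | s <;> simp [ev, psi, cod, phi, h2]
      · refine ⟨hv, ?_⟩
        ext s
        rcases s with s | s | s <;> simp [ev, psi, cod, phi, sx, sf, sg, map_sgn]
    rw [← this.2] at ih
    exact ih this.1

theorem phi_enc (L : List (ι × Bool)) : ∀ w : List (Cd ι),
    phi h (enc L w) = (FreeGroup.lift h (FreeGroup.mk L))⁻¹ * phi h w := by
  induction L with
  | nil => intro w; simp [enc, ← FreeGroup.one_eq_mk]
  | cons c L ih =>
    intro w
    rw [enc, ih, mk_cons, map_mul, map_sgn, FreeGroup.lift_apply_of, phi]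
    simp [mul_assoc]

theorem valid_enc (L : List (ι × Bool)) : ∀ w : List (Cd ι), Valid h w → Valid h (enc L w) := by
  induction L with
  | nil => intro w hw; exact hw
  | cons c L ih => intro w hw; exact ih _ hw

theorem phi_code (Ls : List (List (ι × Bool))) : phi h (code Ls) = 1 := by
  cases Ls <;> rfl

theorem valid_code (Ls : List (List (ι × Bool)))
    (hL : ∀ L ∈ Ls, FreeGroup.lift h (FreeGroup.mk L) = 1) : Valid h (code Ls) := by
  induction Ls with
  | nil => exact ⟨trivial, rfl⟩
  | cons L Ls ih =>
    refine ⟨valid_enc h _ _ (ih fun L' h' => hL L' (List.mem_cons_of_mem _ h')), ?_⟩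
    rw [phi_enc, phi_code, hL L (List.mem_cons_self ..)]
    simp

theorem Pe_snoc (b) (w : List (Cd ι)) (c) : Pe b (w ++ [c]) = ee b c * Pe b w := by
  induction w with
  | nil => simp [Pe]
  | cons d w ih => simp [Pe, ih, mul_assoc]
theorem Pk_snoc (w : List (Cd ι)) (c) : Pk (w ++ [c]) = ek c * Pk w := by
  induction w with
  | nil => simp [Pk]
  | cons d w ih => simp [Pk, ih, mul_assoc]

open Classical in
/-- The model. -/
theorem model [Finite ι] (p : List (Cd ι)) (hp : ∀ u, Rel p u → ev h 1 u = 1) :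
    ∃ (W : Type) (_ : Group W) (g : FreeGroup (Gn ι) →* W) (j : H →* W),
      Function.Injective j ∧ Good g ∧ ∀ i, g (zat p i) = j (h i) := by
  let kp : Unit → (H × FreeGroup (Sy ι × List (Cd ι))) →* ((H × H) × FreeGroup (Sy ι × List (Cd ι))) := fun _ =>
    (MonoidHom.inl H H).prodMap (MonoidHom.id (FreeGroup (Sy ι × List (Cd ι))))
  let kq : Unit → (H × FreeGroup (Sy ι × List (Cd ι))) →* ((H × H) × FreeGroup (Sy ι × List (Cd ι))) := fun _ =>
    ((MonoidHom.id H).prod (MonoidHom.id H)).prodMap (MonoidHom.id (FreeGroup (Sy ι × List (Cd ι))))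
  obtain ⟨M1, _, f1, k1, hf1, hk1⟩ := hnn_many Unit _ _ kp kq
    (by rintro _ ⟨a, b⟩ ⟨c, d⟩ h
        have h1 := congrArg (fun x => x.1.1) h
        have h2 := congrArg (fun x => x.2) h
        exact Prod.ext h1 h2)
    (by rintro _ ⟨a, b⟩ ⟨c, d⟩ h
        have h1 := congrArg (fun x => x.1.1) h
        have h2 := congrArg (fun x => x.2) h
        exact Prod.ext h1 h2)
  -- symbols in ((H × H) × FreeGroup (Sy ι × List (Cd ι)))
  let s0 : Bool → Sy ι → List (Cd ι) → ((H × H) × FreeGroup (Sy ι × List (Cd ι))) := fun b s w =>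
    ((if b = true ∧ w = p then ev h 1 (FreeGroup.of s) else 1, 1), FreeGroup.of (s, w))
  let f2 : ((H × H) × FreeGroup (Sy ι × List (Cd ι))) →* (M1 × FreeGroup (List (Cd ι))) := (MonoidHom.inl _ _).comp f1
  have hf2 : Function.Injective f2 := fun a b hab => hf1 (congrArg Prod.fst hab)
  let k2 : List (Cd ι) → (M1 × FreeGroup (List (Cd ι))) := fun w => (if w = p then k1 () else 1, FreeGroup.of w)
  let p3 : Bool × Cd ι → (FreeGroup (Sy ι × List (Cd ι))) →* (M1 × FreeGroup (List (Cd ι))) := fun x => f2.comp (FreeGroup.lift (fun y : Sy ι × List (Cd ι) => s0 x.1 y.1 y.2))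
  let q3 : Bool × Cd ι → (FreeGroup (Sy ι × List (Cd ι))) →* (M1 × FreeGroup (List (Cd ι))) := fun x =>
    f2.comp (FreeGroup.lift (fun y : Sy ι × List (Cd ι) => s0 x.1 y.1 (y.2 ++ [x.2])))
  obtain ⟨M3, _, f3, t3, hf3, ht3⟩ := hnn_many (Bool × Cd ι) _ _ p3 q3
    (by rintro x
        refine hf2.comp ?_
        have : (MonoidHom.snd (H × H) (FreeGroup (Sy ι × List (Cd ι)))).comp (FreeGroup.lift (fun y : Sy ι × List (Cd ι) => s0 x.1 y.1 y.2)) =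
            MonoidHom.id _ := by ext y; simp [s0]
        refine Function.Injective.of_comp (f := MonoidHom.snd (H × H) (FreeGroup (Sy ι × List (Cd ι)))) ?_
        rw [← MonoidHom.coe_comp, this]; exact fun _ _ h => h)
    (by rintro x
        refine hf2.comp ?_
        have : (MonoidHom.snd (H × H) (FreeGroup (Sy ι × List (Cd ι)))).comp
            (FreeGroup.lift (fun y : Sy ι × List (Cd ι) => s0 x.1 y.1 (y.2 ++ [x.2]))) =
            FreeGroup.map (fun y : Sy ι × List (Cd ι) => (y.1, y.2 ++ [x.2])) := by ext y; simp [s0]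
        refine Function.Injective.of_comp (f := MonoidHom.snd (H × H) (FreeGroup (Sy ι × List (Cd ι)))) ?_
        rw [← MonoidHom.coe_comp, this]
        refine FreeGroup.map_injective ?_
        rintro ⟨a, b⟩ ⟨c, d⟩ h
        simpa using h)
  let p4 : Cd ι → FreeGroup (List (Cd ι)) →* M3 := fun x => f3.comp (FreeGroup.lift k2)
  let q4 : Cd ι → FreeGroup (List (Cd ι)) →* M3 := fun x =>
    f3.comp (FreeGroup.lift (fun w => k2 (w ++ [x])))
  obtain ⟨W, _, f4, t4, hf4, ht4⟩ := hnn_many (Cd ι) _ _ p4 q4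
    (by rintro x
        refine hf3.comp ?_
        have : (MonoidHom.snd M1 (FreeGroup (List (Cd ι)))).comp (FreeGroup.lift k2) =
            MonoidHom.id _ := by ext y; simp [k2]
        refine Function.Injective.of_comp (f := MonoidHom.snd M1 (FreeGroup (List (Cd ι)))) ?_
        rw [← MonoidHom.coe_comp, this]; exact fun _ _ h => h)
    (by rintro x
        refine hf3.comp ?_
        have : (MonoidHom.snd M1 (FreeGroup (List (Cd ι)))).comp
            (FreeGroup.lift (fun w => k2 (w ++ [x]))) =
            FreeGroup.map (fun y => y ++ [x]) := by ext y; simp [k2]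
        refine Function.Injective.of_comp (f := MonoidHom.snd M1 (FreeGroup (List (Cd ι)))) ?_
        rw [← MonoidHom.coe_comp, this]
        refine FreeGroup.map_injective ?_
        intro a b h
        simpa using h)
  let F2 : (M1 × FreeGroup (List (Cd ι))) →* W := f4.comp f3
  have hF2 : Function.Injective F2 := hf4.comp hf3
  let g : FreeGroup (Gn ι) →* W := FreeGroup.lift (Sum.elim
    (Sum.elim (fun x => F2 (f2 (s0 x.1 x.2 []))) (fun x => f4 (t3 x)))
    (Sum.elim (fun _ => F2 (k2 [])) t4))
  have g_sym : ∀ b w s, g (att b w (FreeGroup.of s)) = F2 (f2 (s0 b s w)) := by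
    intro b w s
    induction w using List.reverseRecOn with
    | nil => simp [att_apply, Pe, cls, g]
    | append_singleton w c ih =>
      have h1 : att b (w ++ [c]) (FreeGroup.of s) =
          ee b c * att b w (FreeGroup.of s) * (ee b c)⁻¹ := by
        simp [att_apply, Pe_snoc, mul_assoc]
      have h2 : g (ee b c) = f4 (t3 (b, c)) := by simp [g, ee]
      rw [h1, map_mul, map_mul, map_inv, ih, h2]
      have h3 := ht3 (b, c) (FreeGroup.of (s, w))
      have h4 := congrArg f4 h3
      simpa [p3, q3, F2] using h4
  have g_k : ∀ w, g (kat w) = F2 (k2 w) := by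
    intro w
    induction w using List.reverseRecOn with
    | nil => simp [kat, Pk, kk, g]
    | append_singleton w c ih =>
      have h1 : kat (w ++ [c]) = ek c * kat w * (ek c)⁻¹ := by
        simp [kat, Pk_snoc, mul_assoc]
      have h2 : g (ek c) = t4 c := by simp [g, ek]
      rw [h1, map_mul, map_mul, map_inv, ih, h2]
      have h3 := ht4 c (FreeGroup.of w)
      simpa [p4, q4, F2] using h3
  -- evaluation of words
  have g_att : ∀ b w u, g (att b w u) =
      F2 (f2 ((if b = true ∧ w = p then ev h 1 u else 1, 1), FreeGroup.map (fun s => (s, w)) u)) := by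
    intro b w u
    let e : FreeGroup (Sy ι) →* ((H × H) × FreeGroup (Sy ι × List (Cd ι))) :=
      ((if b = true ∧ w = p then ev h 1 else 1 : FreeGroup (Sy ι) →* H).prod 1).prod
        (FreeGroup.map (fun s => (s, w)))
    have : g.comp (att b w) = (F2.comp f2).comp e := by
      ext s
      refine (g_sym b w s).trans ?_
      simp only [MonoidHom.comp_apply]
      congr 2
      by_cases hb : b = true ∧ w = p <;> simp [s0, e, hb]
    refine (DFunLike.congr_fun this u).trans ?_
    simp only [MonoidHom.comp_apply]
    congr 2
    by_cases hb : b = true ∧ w = p <;> simp [e, hb]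
  -- action of k
  have kcon : ∀ w (a : H) (c : FreeGroup (Sy ι × List (Cd ι))), (w = p ∨ a = 1) →
      F2 (k2 w) * F2 (f2 ((a, 1), c)) * (F2 (k2 w))⁻¹ = F2 (f2 ((a, a), c)) := by
    intro w a c hwa
    rw [← map_mul, ← map_inv, ← map_mul]
    congr 1
    refine Prod.ext ?_ ?_
    · by_cases hw : w = p
      · have := hk1 () (a, c)
        simpa [k2, f2, hw, kp, kq] using this
      · have ha : a = 1 := hwa.resolve_left hw
        simp [k2, f2, hw, ha]
    · simp [k2, f2]
  have g_z : ∀ w i, g (zat w i) = F2 (f2 ((1, if w = p then h i else 1), 1)) := by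
    intro w i
    have h1 := g_att true w (sx i)
    have h2 := kcon w (if true = true ∧ w = p then ev h 1 (sx i) else 1)
      (FreeGroup.map (fun s => (s, w)) (sx i)) (by by_cases hw : w = p <;> simp [hw])
    rw [zat, map_mul, map_mul, map_mul, map_inv, map_inv, h1, g_k, h2, ← map_inv, ← map_inv,
      ← map_mul, ← map_mul]
    congr 2
    by_cases hw : w = p <;> simp [hw, ev, sx]
  refine ⟨W, _, g, F2.comp (f2.comp ((MonoidHom.inl _ _).comp (MonoidHom.inr _ _))), ?_, ?_, ?_⟩
  · intro a b hab
    have := hf2 (hF2 hab)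
    exact congrArg (fun x => x.1.2) this
  · refine ⟨fun w j => ?_, fun w j => ?_, fun w u hr => ?_⟩
    · have h1 := g_att false w (sx j)
      simp only [Bool.false_eq_true, false_and, if_false] at h1
      have h2 := kcon w 1 (FreeGroup.map (fun s => (s, w)) (sx j)) (Or.inr rfl)
      rw [st1, map_mul, map_mul, map_mul, map_inv, map_inv, h1, g_k, h2]
      exact mul_inv_cancel _
    · have h1 := g_att true w (sx j.1)
      rw [st2, map_mul, map_mul, map_mul, map_inv, map_inv, h1, g_z, mul_inv_eq_one,
        mul_inv_eq_iff_eq_mul, ← map_mul, ← map_mul, ← map_mul, ← map_mul]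
      congr 2
      simp
    · rw [dyn, map_mul, map_inv, g_att, g_att, mul_inv_eq_one]
      congr 2
      by_cases hw : w = p
      · subst hw
        simp [hp u hr]
      · simp [hw]
  · intro i
    rw [g_z]
    simp

end Model

theorem main_emb [Finite ι] (R : Set (FreeGroup ι)) (hR : R.Finite) :
    ∃ ξ : FreeGroup ι →* FreeGroup (Gn ι), ∀ u, NN (ξ u) ↔ u ∈ Subgroup.normalClosure R := by
  classical
  let Ls : List (List (ι × Bool)) := hR.toFinset.toList.map FreeGroup.toWord
  have hLs : ∀ r ∈ R, r.toWord ∈ Ls := fun r hr =>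
    List.mem_map.2 ⟨r, by simpa using hr, rfl⟩
  refine ⟨FreeGroup.lift (zat (code Ls)), fun u => ⟨fun hu => ?_, fun hu => ?_⟩⟩
  · let h : ι → FreeGroup ι ⧸ Subgroup.normalClosure R := fun i => QuotientGroup.mk (FreeGroup.of i)
    have hlift : ∀ u, FreeGroup.lift h u = QuotientGroup.mk u := by
      intro u
      have : FreeGroup.lift h = QuotientGroup.mk' (Subgroup.normalClosure R) := by
        ext i; simp [h]
      exact DFunLike.congr_fun this u
    have hv : Valid h (code Ls) := by
      refine valid_code h Ls fun L hL => ?_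
      obtain ⟨r, hr, rfl⟩ := List.mem_map.1 hL
      rw [FreeGroup.mk_toWord, hlift]
      refine (QuotientGroup.eq_one_iff r).2 (Subgroup.subset_normalClosure ?_)
      simpa using hr
    obtain ⟨W, _, g, j, hj, hg, hz⟩ := model h (code Ls) (fun u hr => by
      have := rel_ev h hr hv
      rwa [phi_code] at this)
    have h1 := good_kills hu g hg
    have h2 : g.comp (FreeGroup.lift (zat (code Ls))) = j.comp (FreeGroup.lift h) := by
      ext i; simp [hz]
    have h3 : j (FreeGroup.lift h u) = 1 := by
      rw [← h1]; exact (DFunLike.congr_fun h2 u).symm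
    rw [hlift] at h3
    exact (QuotientGroup.eq_one_iff u).1 (hj (h3.trans (map_one j).symm))
  · have : Subgroup.normalClosure R ≤
        (LNs (seeds ι) theta).comap (FreeGroup.lift (zat (code Ls))) := by
      refine Subgroup.normalClosure_le_normal ?_
      intro r hr
      have h1 := nn_code Ls _ (hLs r hr)
      rw [FreeGroup.mk_toWord] at h1
      exact nn_rope _ _ h1
    exact this hu

end Machine

end UnivFP

/-- (Higman, 1961.) There exists a universal finitely presented group: a finitely presented
group `U` into which every finitely presented group embeds. -/
theorem exists_universal_finitely_presented_group :
    ∃ (U : Type) (_ : Group U) (n : ℕ) (R : Finset (FreeGroup (Fin n))),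
      Nonempty (U ≃* FreeGroup (Fin n) ⧸
        Subgroup.normalClosure (R : Set (FreeGroup (Fin n)))) ∧
      ∀ (G : Type) (_ : Group G),
        (∃ (m : ℕ) (S : Finset (FreeGroup (Fin m))),
          Nonempty (G ≃* FreeGroup (Fin m) ⧸
            Subgroup.normalClosure (S : Set (FreeGroup (Fin m))))) →
        ∃ i : G →* U, Function.Injective i := by
  classical
  let RR := UnivFP.RR (UnivFP.seeds (Fin 4)) UnivFP.theta
  have hfin : RR.Finite := UnivFP.RR_finite _ _ UnivFP.seeds_finite
  obtain ⟨n, ⟨e⟩⟩ := Finite.exists_equiv_fin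
    (UnivFP.Bt (UnivFP.Gn (Fin 4)) (Option (UnivFP.Cd (Fin 4))))
  obtain ⟨η, hη⟩ := UnivFP.thmT (UnivFP.seeds (Fin 4)) UnivFP.theta
  let E := FreeGroup.freeGroupCongr e
  refine ⟨PresentedGroup RR, inferInstance, n, (hfin.image E).toFinset, ⟨?_⟩, ?_⟩
  · refine QuotientGroup.congr _ _ E ?_
    rw [Set.Finite.coe_toFinset]
    exact Subgroup.map_normalClosure RR E.toMonoidHom E.surjective
  · rintro G _ ⟨m, S, ⟨k⟩⟩
    obtain ⟨ζ, hζ⟩ := UnivFP.four_gen m (S : Set (FreeGroup (Fin m)))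
    obtain ⟨ξ, hξ⟩ := UnivFP.main_emb (ζ '' (S : Set (FreeGroup (Fin m)))) (S.finite_toSet.image ζ)
    let F : FreeGroup (Fin m) →* PresentedGroup RR := η.comp (ξ.comp ζ)
    have hF : ∀ u, F u = 1 ↔ u ∈ Subgroup.normalClosure (S : Set (FreeGroup (Fin m))) := by
      intro u
      refine ((hη _).trans (hξ _)).trans ⟨hζ u, fun hu => ?_⟩
      have : Subgroup.normalClosure (S : Set (FreeGroup (Fin m))) ≤
          (Subgroup.normalClosure (ζ '' (S : Set (FreeGroup (Fin m))))).comap ζ :=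
        Subgroup.normalClosure_le_normal fun r hr =>
          Subgroup.subset_normalClosure ⟨r, hr, rfl⟩
      exact this hu
    let F' : (FreeGroup (Fin m) ⧸ Subgroup.normalClosure (S : Set (FreeGroup (Fin m)))) →*
        PresentedGroup RR := QuotientGroup.lift _ F (fun u hu => (hF u).2 hu)
    have hF' : Function.Injective F' := by
      rw [injective_iff_map_eq_one]
      intro x hx
      obtain ⟨u, rfl⟩ := QuotientGroup.mk_surjective x
      exact (QuotientGroup.eq_one_iff u).2 ((hF u).1 hx)
    exact ⟨F'.comp k.toMonoidHom, hF'.comp k.injective⟩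
end

section
/- (Marshall Hall Jr., 1949.) Every countable semigroup embeds into a semigroup generated by two elements: if S is a countable semigroup, then there exists a semigroup T, an injective semigroup homomorphism S →ₙ* T, and elements a, b ∈ T such that the subsemigroup generated by {a, b} is all of T (Subsemigroup.closure {a, b} = ⊤). -/
namespace HallEmb

theorem mul_ap {X : Type*} (f g : Function.End X) (x : X) : (f * g) x = f (g x) := rfl

variable {S : Type*} [Semigroup S]

def fa : Function.End (Option (WithOne S × ℕ))
  | some (m, k + 1) => some (m, k + 2)
  | _ => none

def fb (e : ℕ → WithOne S) : Function.End (Option (WithOne S × ℕ))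
  | some (m, 0) => some (m, 1)
  | some (m, k + 1) => some (e k * m, 0)
  | none => none

def phiFun (s : S) : Function.End (Option (WithOne S × ℕ))
  | some (m, 0) => some ((s : WithOne S) * m, 0)
  | _ => none

def phi : S →ₙ* Function.End (Option (WithOne S × ℕ)) where
  toFun := phiFun
  map_mul' s t := by
    funext x
    rcases x with _ | ⟨m, _ | k⟩
    · rfl
    · simp [phiFun, mul_ap, mul_assoc]
    · rfl

theorem phi_inj : Function.Injective (phi (S := S)) := by
  intro s t h
  have : phiFun s (some (1, 0)) = phiFun t (some (1, 0)) := congrFun h (some (1, 0))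
  simpa [phiFun] using this

theorem fa_iter (n : ℕ) (m : WithOne S) (k : ℕ) :
    (fa ^ n) (some (m, k + 1)) = some (m, k + 1 + n) := by
  induction n with
  | zero => rfl
  | succ n ih =>
    rw [pow_succ', mul_ap, ih,
      show k + 1 + n = (k + n) + 1 by omega]
    simp only [fa]
    congr 2
    omega

theorem fa_iter_none (n : ℕ) : (fa (S := S) ^ n) none = none := by
  induction n with
  | zero => rfl
  | succ n ih => rw [pow_succ', mul_ap, ih]; rfl

theorem fa_iter_zero (n : ℕ) (m : WithOne S) : (fa ^ (n + 1)) (some (m, 0)) = none := by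
  rw [pow_succ, mul_ap]
  exact fa_iter_none n

theorem word (e : ℕ → WithOne S) (n : ℕ) (s : S) (h : e (n + 1) = s) :
    fb e * fa ^ (n + 1) * fb e = phi s := by
  funext x
  simp only [mul_ap]
  rcases x with _ | ⟨m, _ | k⟩
  · simp only [fb, fa_iter_none]; rfl
  · have := fa_iter (n + 1) m 0
    simp only [zero_add] at this
    simp only [fb, this]
    rw [show Nat.add 1 n = n + 1 from Nat.add_comm 1 n, h]; rfl
  · simp only [fb, fa_iter_zero]; rfl

theorem phi_mem (e : ℕ → WithOne S) (he : ∀ s : S, ∃ n, e (n + 1) = s) (s : S) :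
    phi s ∈ Subsemigroup.closure {fa, fb e} := by
  obtain ⟨n, hn⟩ := he s
  rw [← word e n s hn]
  have ha : fa ∈ Subsemigroup.closure {fa, fb e} := Subsemigroup.subset_closure (by simp)
  have hb : fb e ∈ Subsemigroup.closure {fa, fb e} := Subsemigroup.subset_closure (by simp)
  refine mul_mem (mul_mem hb ?_) hb
  clear hn
  induction n with
  | zero => simpa using ha
  | succ n ih => rw [pow_succ]; exact mul_mem ih ha

theorem exists_enum [Countable S] : ∃ e : ℕ → WithOne S, ∀ s : S, ∃ n, e (n + 1) = s := by
  have : Countable (WithOne S) := inferInstanceAs (Countable (Option S))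
  obtain ⟨f, hf⟩ := exists_surjective_nat (WithOne S)
  refine ⟨fun n => f (n - 1), fun s => ?_⟩
  obtain ⟨n, hn⟩ := hf s
  exact ⟨n, by simpa using hn⟩

theorem closure_sub {U : Type*} [Semigroup U] (a b : U)
    (ha : a ∈ Subsemigroup.closure {a, b}) (hb : b ∈ Subsemigroup.closure {a, b}) :
    Subsemigroup.closure {(⟨a, ha⟩ : Subsemigroup.closure {a, b}), ⟨b, hb⟩} = ⊤ := by
  rw [← Subsemigroup.closure_closure_coe_preimage (s := {a, b})]
  congr 1
  ext ⟨x, hx⟩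
  simp

theorem aux.{u, v} (S : Type u) [Semigroup S] [Countable S] :
    ∃ (T : Type v) (_ : Semigroup T) (i : S →ₙ* T) (a b : T),
      Function.Injective i ∧ Subsemigroup.closure {a, b} = (⊤ : Subsemigroup T) := by
  have : Countable (Shrink.{v} S) := (equivShrink.{v} S).symm.injective.countable
  obtain ⟨e, he⟩ := exists_enum (S := Shrink.{v} S)
  refine ⟨Subsemigroup.closure {fa, fb e}, inferInstance,
    (phi.codRestrict _ (phi_mem e he)).comp (Shrink.mulEquiv.{v} (α := S)).symm.toMulHom,
    ⟨fa, Subsemigroup.subset_closure (by simp)⟩,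
    ⟨fb e, Subsemigroup.subset_closure (by simp)⟩, ?_, closure_sub _ _ _ _⟩
  intro s t h
  exact (Shrink.mulEquiv.{v} (α := S)).symm.injective (phi_inj (congrArg Subtype.val h))

end HallEmb

/-- (Marshall Hall Jr., 1949.) Every countable semigroup embeds into a semigroup generated
by two elements. -/
theorem countable_semigroup_embeds_two_generated (S : Type*) [Semigroup S] [Countable S] :
    ∃ (T : Type*) (_ : Semigroup T) (i : S →ₙ* T) (a b : T),
      Function.Injective i ∧ Subsemigroup.closure {a, b} = (⊤ : Subsemigroup T) := by
  exact HallEmb.aux S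
end
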